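/- arXiv:1210.4494 — 4 statements merged into one kernel-verified Lean document; each statement's English description precedes it below -/
import Mathlib

section
/- Assume e = N = 3, p ≡ 1 (mod 3), 3 | m (so 3 | ms), and 3 does not divide (q−1)/h. Write η₁ = η_1^{(3,r)}, η_α = η_α^{(3,r)}, η_{α²} = η_{α²}^{(3,r)}, and set T = (−1)^{ms}(π^{ms} + π̄^{ms}), A = (−1)^{ms}(u(α)² π^{ms} + u(α) π̄^{ms}), B = (−1)^{ms}(u(α) π^{ms} + u(α)² π̄^{ms}). Then the modified weight λ(a,b), as (a,b) ranges over GF(r)², takes only the values listed below, and for every real number x, the number of pairs (a,b) ∈ GF(r)² with λ(a,b) = x equals the sum of the following frequencies over those listed values that equal x: (3h/q)η₁, (3h/q)η_α, (3h/q)η_{α²} each with frequency (r−1)(r+1−T)/27; (h/q)(2η₁+η_α) with frequency (r−1)(r−2−A)/9; (h/q)(2η₁+η_{α²}) with frequency (r−1)(r−2−B)/9; (h/q)(2η_α+η₁) with frequency (r−1)(r−2−B)/9; (h/q)(2η_α+η_{α²}) with frequency (r−1)(r−2−A)/9; (h/q)(2η_{α²}+η₁) with frequency (r−1)(r−2−A)/9;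 (h/q)(2η_{α²}+η_α) with frequency (r−1)(r−2−B)/9; −h/q with frequency (r−1)(2r−7−2T)/9; (h/q)((r−1)/3+η₁+η_α), (h/q)((r−1)/3+η₁+η_{α²}), (h/q)((r−1)/3+η_α+η_{α²}) each with frequency r−1; h(r−1)/q with frequency 1. -/
open scoped Classical

/-- The ring of Eisenstein integers. -/
abbrev EisensteinInt : Type := QuadraticAlgebra ℤ (-1) (-1)

namespace EisensteinInt

theorem exists_mul_pow_of_norm_eq {F : Type*} [Field F] {p : ℕ} [CharP F p]
    (φ : EisensteinInt →+* F) (π : EisensteinInt) (hπ : π.norm = p) (hp : p ≠ 0)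
    (hφπ : φ π = 0) (him : (π.im : F) ≠ 0) (k : ℕ) :
    ∀ x : EisensteinInt, x.norm = p ^ k → φ (star x) ≠ 0 →
      ∃ y : EisensteinInt, y.norm = 1 ∧ x = y * π ^ k := by
  have hφ : ∀ z : EisensteinInt, φ z = z.re + z.im * φ ⟨0, 1⟩ := by
    intro z
    have : z = (z.re : EisensteinInt) + z.im * ⟨0, 1⟩ := by
      ext <;> simp
    conv_lhs => rw [this]
    rw [map_add, map_mul, map_intCast, map_intCast]
  induction k with
  | zero => intro x hx _; exact ⟨x, by simpa using hx, by simp⟩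
  | succ k ih =>
    intro x hx hsx
    have hφx : φ x = 0 := by
      have h1 : φ x * φ (star x) = 0 := by
        rw [← map_mul, ← QuadraticAlgebra.algebraMap_norm_eq_mul_star, hx]
        simp
      exact (mul_eq_zero.mp h1).resolve_right hsx
    have hdiv : ∃ y, x = y * π := by
      have h1 := hφ x
      have h2 := hφ π
      rw [hφx] at h1
      rw [hφπ] at h2
      set w := φ ⟨0, 1⟩
      have hN : ((π.norm : ℤ) : F) = 0 := by rw [hπ]; simp
      simp only [QuadraticAlgebra.norm_def] at hN
      push_cast at hN
      have e2 : (p : ℤ) ∣ x.im * π.re - x.re * π.im := by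
        rw [← CharP.intCast_eq_zero_iff F p]
        push_cast
        linear_combination π.im * h1 - x.im * h2
      have e1 : (p : ℤ) ∣ x.re * π.re - x.re * π.im + x.im * π.im := by
        rw [← CharP.intCast_eq_zero_iff F p]
        refine (mul_eq_zero.mp ?_).resolve_left him
        push_cast
        rw [← CharP.intCast_eq_zero_iff F p] at e2
        push_cast at e2
        linear_combination x.im * hN + (π.im - π.re) * e2
      obtain ⟨c, hc⟩ := e1
      obtain ⟨d, hd⟩ := e2
      refine ⟨⟨c, d⟩, ?_⟩
      have hp' : (p : ℤ) ≠ 0 := by exact_mod_cast hp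
      rw [QuadraticAlgebra.norm_def] at hπ
      ext
      · apply mul_left_cancel₀ hp'
        simp only [QuadraticAlgebra.re_mul]
        linear_combination -x.re * hπ + π.re * hc - π.im * hd
      · apply mul_left_cancel₀ hp'
        simp only [QuadraticAlgebra.im_mul]
        linear_combination -x.im * hπ + π.im * hc + (π.re - π.im) * hd
    obtain ⟨y, rfl⟩ := hdiv
    obtain ⟨z, hz, rfl⟩ := ih y (by
      rw [map_mul, hπ, pow_succ] at hx
      exact mul_right_cancel₀ (by exact_mod_cast hp) hx) (by
      intro h0; apply hsx; rw [star_mul, map_mul, h0, mul_zero])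
    exact ⟨z, hz, by ring⟩

theorem dvd_iff (n : ℤ) (z : EisensteinInt) :
    (n : EisensteinInt) ∣ z ↔ n ∣ z.re ∧ n ∣ z.im := by
  constructor
  · rintro ⟨w, rfl⟩; simp
  · rintro ⟨⟨a, ha⟩, ⟨b, hb⟩⟩
    exact ⟨⟨a, b⟩, by ext <;> simp [ha, hb]⟩

theorem eq_neg_pow_mul_of_dvd {π y : EisensteinInt} {k : ℕ} (hπ : ((3 : ℤ) : EisensteinInt) ∣ π + 1)
    (hx : ((3 : ℤ) : EisensteinInt) ∣ y * π ^ k + 1) (hy : y.norm = 1) : y = (-1) ^ (k + 1) := by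
  have h1 : ((3 : ℤ) : EisensteinInt) ∣ π ^ k - (-1) ^ k :=
    (by simpa using hπ : ((3 : ℤ) : EisensteinInt) ∣ π - (-1)).trans (sub_dvd_pow_sub_pow _ _ _)
  have h2 : ((3 : ℤ) : EisensteinInt) ∣ y * (-1) ^ k + 1 := by
    have := dvd_sub hx (h1.mul_left y)
    convert this using 1; ring
  rw [QuadraticAlgebra.norm_def] at hy
  have key : ∀ ε : ℤ, (ε = 1 ∨ ε = -1) → ((3 : ℤ) : EisensteinInt) ∣ y * (ε : EisensteinInt) + 1 →
      y = ((-ε : ℤ) : EisensteinInt) := by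
    intro ε hε hd
    obtain ⟨d1, d2⟩ := (dvd_iff _ _).mp hd
    have him : y.im = 0 := by
      have : 3 ∣ y.im := by rcases hε with rfl | rfl <;> simpa [QuadraticAlgebra.im_one] using d2
      have h3 : y.im < 2 := by nlinarith [sq_nonneg (2 * y.re - y.im)]
      have h4 : -2 < y.im := by nlinarith [sq_nonneg (2 * y.re - y.im)]
      omega
    have hre : y.re = 1 ∨ y.re = -1 := by
      rw [him] at hy
      exact mul_self_eq_one_iff.mp (by linarith)
    ext
    · rcases hε with rfl | rfl <;> rcases hre with h | h <;> simp [h, QuadraticAlgebra.re_one] at d1 ⊢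
    · simp [him]
  rcases neg_one_pow_eq_or EisensteinInt k with h | h
  · rw [pow_succ, h]
    rw [h] at h2
    simpa using key 1 (by simp) (by simpa using h2)
  · rw [pow_succ, h]
    rw [h] at h2
    simpa using key (-1) (by simp) (by simpa using h2)

end EisensteinInt

namespace FiniteField

theorem sum_pow_eq_ite {F : Type*} [Field F] [Fintype F] {i : ℕ} (hi : i ≠ 0) :
    ∑ x : F, x ^ i = if Fintype.card F - 1 ∣ i then -1 else 0 := by
  let φ : Fˣ ↪ F := ⟨fun x ↦ x, Units.val_injective⟩
  have : Finset.univ.map φ = Finset.univ \ {0} := by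
    ext x
    simpa only [Finset.mem_map, Finset.mem_univ, Function.Embedding.coeFn_mk, true_and,
      Finset.mem_sdiff, Finset.mem_singleton, φ] using! isUnit_iff_ne_zero
  rw [← FiniteField.sum_pow_units, ← Finset.sum_sdiff ({0} : Finset F).subset_univ,
    Finset.sum_singleton, zero_pow hi, add_zero, ← this, Finset.sum_map]
  rfl

theorem sum_pow_mul_one_sub_pow {F : Type*} [Field F] [Fintype F] (a b : ℕ) (ha : a ≠ 0) :
    ∑ x : F, x ^ a * (1 - x) ^ b =
      ∑ j ∈ Finset.range (b + 1), (-1) ^ j * (b.choose j : F) *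
        if Fintype.card F - 1 ∣ a + j then -1 else 0 := by
  have : ∀ x : F, x ^ a * (1 - x) ^ b =
      ∑ j ∈ Finset.range (b + 1), (-1) ^ j * (b.choose j : F) * x ^ (a + j) := by
    intro x
    rw [sub_eq_neg_add, add_pow, Finset.mul_sum]
    refine Finset.sum_congr rfl fun j _ => ?_
    rw [neg_pow]; ring
  simp_rw [this]
  rw [Finset.sum_comm]
  refine Finset.sum_congr rfl fun j _ => ?_
  rw [← Finset.mul_sum, sum_pow_eq_ite (by omega)]

end FiniteField

theorem Nat.not_dvd_choose_two_mul_of_three_mul_add_one_eq {p : ℕ} (hp : p.Prime) (hp3 : p % 3 = 1)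
    (k : ℕ) : ∀ M, 3 * M + 1 = p ^ k → ¬ p ∣ (2 * M).choose M := by
  have := Fact.mk hp
  induction k with
  | zero =>
    intro M hM
    have : M = 0 := by simpa using hM
    subst this
    simpa using hp.one_lt.ne'
  | succ k ih =>
    intro M hM
    obtain ⟨t, ht⟩ : ∃ t, p = 3 * t + 1 := ⟨p / 3, by omega⟩
    obtain ⟨M', hM'⟩ : ∃ M', 3 * M' + 1 = p ^ k := by
      have : p ^ k % 3 = 1 := by rw [Nat.pow_mod, hp3]; simp
      exact ⟨p ^ k / 3, by omega⟩
    have hMM : M = p * M' + t := by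
      rw [pow_succ, ← hM'] at hM
      nlinarith
    have hmod : M % p = t ∧ M / p = M' := by
      rw [hMM, Nat.mul_add_mod, Nat.mul_add_div hp.pos]
      exact ⟨Nat.mod_eq_of_lt (by omega), by rw [Nat.div_eq_of_lt (by omega), add_zero]⟩
    have hmod2 : (2 * M) % p = 2 * t ∧ (2 * M) / p = 2 * M' := by
      have : 2 * M = p * (2 * M') + 2 * t := by rw [hMM]; ring
      rw [this, Nat.mul_add_mod, Nat.mul_add_div hp.pos]
      exact ⟨Nat.mod_eq_of_lt (by omega), by rw [Nat.div_eq_of_lt (by omega), add_zero]⟩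
    have := Choose.choose_modEq_choose_mod_mul_choose_div_nat (p := p) (n := 2 * M) (k := M)
    rw [hmod.1, hmod.2, hmod2.1, hmod2.2] at this
    rw [this.dvd_iff dvd_rfl, hp.dvd_mul, not_or]
    refine ⟨?_, ih _ hM'⟩
    intro hd
    have hdf : p ∣ (2 * t).factorial := by
      rw [← Nat.choose_mul_factorial_mul_factorial (show t ≤ 2 * t by omega), mul_assoc]
      exact hd.mul_right _
    have := hp.dvd_factorial.mp hdf
    omega

namespace EisensteinInt

/-- The ring homomorphism out of the Eisenstein integers sending `ω` to a root of `X² + X + 1`. -/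
noncomputable def evalHom {A : Type*} [CommRing A] (u : A) (hu : u ^ 2 + u + 1 = 0) :
    EisensteinInt →+* A :=
  (QuadraticAlgebra.lift ⟨u, by
    rw [neg_smul, neg_smul, one_smul, one_smul]; linear_combination hu⟩ :
      QuadraticAlgebra ℤ (-1) (-1) →ₐ[ℤ] A)

theorem evalHom_apply {A : Type*} [CommRing A] (u : A) (hu : u ^ 2 + u + 1 = 0)
    (z : EisensteinInt) : evalHom u hu z = z.re + z.im * u := by
  simp [evalHom]

theorem evalHom_complex_injective (u : ℂ) (hu : u ^ 2 + u + 1 = 0) :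
    Function.Injective (evalHom u hu) := by
  rw [injective_iff_map_eq_zero]
  intro z hz
  rw [evalHom_apply] at hz
  have h1 : ((z.re ^ 2 - z.re * z.im + z.im ^ 2 : ℤ) : ℂ) = 0 := by
    push_cast
    linear_combination (z.re - z.im - z.im * u : ℂ) * hz + (z.im : ℂ) ^ 2 * hu
  have h2 : z.re ^ 2 - z.re * z.im + z.im ^ 2 = 0 := by exact_mod_cast h1
  have h3 : z.im = 0 := by
    by_contra h
    have := sq_pos_of_ne_zero (a := z.im) h
    nlinarith [sq_nonneg (2 * z.re - z.im)]
  ext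
  · simpa [h3] using h2
  · simpa using h3

theorem exists_sq_add_self_add_one_eq_zero : ∃ u : ℂ, u ^ 2 + u + 1 = 0 := by
  have h := (Complex.isPrimitiveRoot_exp 3 (by norm_num)).geom_sum_eq_zero (by norm_num)
  exact ⟨_, by rw [← h]; simp [Finset.sum_range_succ]; ring⟩

instance : IsDomain EisensteinInt :=
  let ⟨u, hu⟩ := exists_sq_add_self_add_one_eq_zero
  (evalHom_complex_injective u hu).isDomain _

theorem omega_isPrimitiveRoot : IsPrimitiveRoot (⟨0, 1⟩ : EisensteinInt) 3 := by
  rw [IsPrimitiveRoot.iff_orderOf]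
  refine orderOf_eq_prime ?_ ?_
  · ext <;> simp [pow_succ, QuadraticAlgebra.re_one, QuadraticAlgebra.im_one]
  · intro h
    simpa [QuadraticAlgebra.im_one] using congrArg QuadraticAlgebra.im h

end EisensteinInt

section Jacobi

theorem MulChar.ringHomComp_star_eq_inv {F : Type*} [Field F] {χ : MulChar F EisensteinInt} (hχ : χ ^ 3 = 1) :
    χ.ringHomComp (starRingEnd EisensteinInt) = χ⁻¹ := by
  rw [eq_inv_iff_mul_eq_one]
  refine MulChar.ext fun x => ?_
  rw [MulChar.mul_apply, MulChar.one_apply_coe, MulChar.ringHomComp_apply, starRingEnd_apply,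
    mul_comm, ← QuadraticAlgebra.algebraMap_norm_eq_mul_star]
  have h1 : χ x ^ 3 = 1 := by
    rw [← MulChar.pow_apply_coe, hχ, MulChar.one_apply_coe]
  have h2 : (χ x).norm ^ 3 = 1 := by rw [← map_pow, h1, map_one]
  have h3 : (χ x).norm = 1 := by
    have : (χ x).norm - 1 = 0 ∨ (χ x).norm ^ 2 + (χ x).norm + 1 = 0 := by
      rw [← mul_eq_zero]; linear_combination h2
    rcases this with h | h
    · linarith
    · nlinarith [sq_nonneg (2 * (χ x).norm + 1)]
  rw [h3, map_one]

variable {F : Type*} [Field F] [Fintype F]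

theorem norm_jacobiSum_self {χ : MulChar F EisensteinInt} (hχ : χ ^ 3 = 1) (h1 : χ ≠ 1) :
    (jacobiSum χ χ).norm = Fintype.card F := by
  obtain ⟨u, hu⟩ := EisensteinInt.exists_sq_add_self_add_one_eq_zero
  set ι := EisensteinInt.evalHom u hu
  have hι := EisensteinInt.evalHom_complex_injective u hu
  have h2 : χ * χ ≠ 1 := by
    intro h
    apply h1
    rwa [pow_succ, pow_two, h, one_mul] at hχ
  have hne : ringChar ℂ ≠ ringChar F := by
    rw [ringChar.eq ℂ 0]
    exact (CharP.ringChar_ne_zero_of_finite F).symm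
  have h3 := jacobiSum_mul_jacobiSum_inv hne (χ := χ.ringHomComp ι) (φ := χ.ringHomComp ι)
    ((MulChar.ringHomComp_ne_one_iff hι).mpr h1) ((MulChar.ringHomComp_ne_one_iff hι).mpr h1)
    (by rw [← MulChar.ringHomComp_mul]; exact (MulChar.ringHomComp_ne_one_iff hι).mpr h2)
  rw [MulChar.ringHomComp_inv, jacobiSum_ringHomComp, jacobiSum_ringHomComp,
    ← MulChar.ringHomComp_star_eq_inv hχ, jacobiSum_ringHomComp, ← map_mul, starRingEnd_apply,
    ← QuadraticAlgebra.algebraMap_norm_eq_mul_star] at h3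
  have h4 : ((jacobiSum χ χ).norm : ℂ) = (Fintype.card F : ℂ) := by simpa using h3
  exact_mod_cast h4

theorem jacobiSum_self_eq_neg_pow {p k M : ℕ} (hp : p.Prime) (hp3 : p % 3 = 1) [CharP F p]
    (hcard : Fintype.card F = p ^ k) (hM : 3 * M + 1 = p ^ k) (hM0 : M ≠ 0)
    {χ : MulChar F EisensteinInt} (hχ : χ ^ 3 = 1) (h1 : χ ≠ 1)
    (φ : EisensteinInt →+* F) (hφχ : ∀ x, φ (χ x) = x ^ M)
    {π : EisensteinInt} (hπ : π.norm = p) (hπ3 : ((3 : ℤ) : EisensteinInt) ∣ π + 1)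
    (hφπ : φ π = 0) (him : (π.im : F) ≠ 0) :
    jacobiSum χ χ = (-1) ^ (k + 1) * π ^ k := by
  have hstar : φ (star (jacobiSum χ χ)) ≠ 0 := by
    have hinv : χ⁻¹ = χ ^ 2 := by
      rw [inv_eq_iff_mul_eq_one, ← pow_succ', hχ]
    rw [← starRingEnd_apply, ← jacobiSum_ringHomComp, MulChar.ringHomComp_star_eq_inv hχ, hinv,
      jacobiSum, map_sum]
    have h2 : ∀ x : F, φ ((χ ^ 2) x * (χ ^ 2) (1 - x)) = x ^ (2 * M) * (1 - x) ^ (2 * M) := by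
      intro x
      rw [MulChar.pow_apply' _ two_ne_zero, MulChar.pow_apply' _ two_ne_zero, map_mul, map_pow,
        map_pow, hφχ, hφχ]
      ring
    simp_rw [h2]
    rw [FiniteField.sum_pow_mul_one_sub_pow _ _ (by omega), Finset.sum_eq_single M]
    · rw [if_pos (by rw [hcard, ← hM]; exact ⟨1, by omega⟩)]
      refine mul_ne_zero (mul_ne_zero (pow_ne_zero _ (by simp)) ?_) (by simp)
      rw [Ne, CharP.cast_eq_zero_iff F p]
      exact Nat.not_dvd_choose_two_mul_of_three_mul_add_one_eq hp hp3 k M hM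
    · intro j hj hjM
      rw [if_neg, mul_zero]
      rw [hcard, ← hM]
      rintro ⟨c, hc⟩
      have : j ≤ 2 * M := by simpa [Nat.lt_succ_iff] using hj
      have hc0 : c = 1 := by
        rcases c with _ | _ | c
        · omega
        · rfl
        · exfalso
          have h4 : 3 * M * 2 ≤ 3 * M * (c + 1 + 1) := Nat.mul_le_mul_left _ (by omega)
          rw [Nat.add_sub_cancel] at hc
          omega
      subst hc0
      omega
    · intro h
      simp at h
      omega
  obtain ⟨y, hy, hJ⟩ := EisensteinInt.exists_mul_pow_of_norm_eq φ π hπ hp.ne_zero hφπ him k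
    (jacobiSum χ χ) (by rw [norm_jacobiSum_self hχ h1, hcard]; push_cast; rfl) hstar
  rw [hJ]
  congr 1
  refine EisensteinInt.eq_neg_pow_mul_of_dvd hπ3 ?_ hy
  rw [← hJ]
  obtain ⟨z, -, hz⟩ := exists_jacobiSum_eq_neg_one_add (by norm_num) hχ hχ
    (by rw [hcard, ← hM]; exact ⟨M, by omega⟩) EisensteinInt.omega_isPrimitiveRoot
  refine ⟨-⟨0, 1⟩ * z, ?_⟩
  rw [hz]
  have : ((⟨0, 1⟩ : EisensteinInt) - 1) ^ 2 = -((3 : ℤ) : EisensteinInt) * ⟨0, 1⟩ := by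
    ext <;> simp [-Int.cast_ofNat, pow_two, QuadraticAlgebra.re_one, QuadraticAlgebra.im_one]
  rw [this]
  ring
theorem exists_mulChar_jacobiSum_eq {p k M : ℕ} (hp : p.Prime) (hp3 : p % 3 = 1) [CharP F p]
    (hcard : Fintype.card F = p ^ k) (hM : 3 * M + 1 = p ^ k) (hM0 : M ≠ 0)
    {α : Fˣ} (hα : ∀ x : Fˣ, x ∈ Subgroup.zpowers α)
    {a₀ b₀ : ℤ} (hpab : (p : ℤ) = a₀ ^ 2 - a₀ * b₀ + b₀ ^ 2)
    (ha₀ : a₀ % 3 = 2) (hb₀ : b₀ % 3 = 0) (hb₀F : (b₀ : F) ≠ 0)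
    {γ : F} (hγ : (a₀ : F) + b₀ * γ = 0)
    {ω : ℂ} (hω : ω ^ 2 + ω + 1 = 0) (hωc : starRingEnd ℂ ω = ω ^ 2) {u : ℂ}
    (hu : ((α : F) ^ M = γ ∧ u = ω) ∨ ((α : F) ^ M = γ ^ 2 ∧ u = ω ^ 2)) :
    ∃ χ : MulChar F ℂ, χ ^ 3 = 1 ∧ χ α = u ∧
      jacobiSum χ χ = (-1) ^ (k + 1) * (a₀ + b₀ * ω) ^ k ∧
      jacobiSum χ⁻¹ χ⁻¹ = (-1) ^ (k + 1) * (starRingEnd ℂ (a₀ + b₀ * ω)) ^ k := by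
  have hγ2 : γ ^ 2 + γ + 1 = 0 := by
    have h0 : ((p : ℤ) : F) = 0 := by simp
    rw [hpab] at h0
    push_cast at h0
    refine (mul_eq_zero.mp ?_).resolve_left (pow_ne_zero 2 hb₀F)
    linear_combination h0 + (b₀ * γ - a₀ + b₀) * hγ
  set φ := EisensteinInt.evalHom γ hγ2 with hφ
  set ι := EisensteinInt.evalHom ω hω with hι
  obtain ⟨z, hz3, hφz, hιz, hz1⟩ : ∃ z : EisensteinInt, z ^ 3 = 1 ∧ φ z = α ^ M ∧ ι z = u ∧
      z ≠ 1 := by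
    have h3 := EisensteinInt.omega_isPrimitiveRoot
    rcases hu with ⟨h, rfl⟩ | ⟨h, rfl⟩
    · refine ⟨⟨0, 1⟩, h3.pow_eq_one, ?_, ?_, h3.ne_one (by norm_num)⟩
      · rw [h, hφ, EisensteinInt.evalHom_apply]; simp
      · rw [hι, EisensteinInt.evalHom_apply]; simp
    · refine ⟨⟨0, 1⟩ ^ 2, ?_, ?_, ?_, h3.pow_ne_one_of_pos_of_lt (by norm_num) (by norm_num)⟩
      · rw [← pow_mul, mul_comm, pow_mul, h3.pow_eq_one, one_pow]
      · rw [h, map_pow, hφ, EisensteinInt.evalHom_apply]; simp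
      · rw [map_pow, hι, EisensteinInt.evalHom_apply]; simp
  have hcu : Fintype.card Fˣ = 3 * M := by
    rw [Fintype.card_units, hcard, ← hM, Nat.add_sub_cancel]
  let ζ : EisensteinIntˣ := Units.ofPowEqOne z 3 hz3 (by norm_num)
  have hζ : ζ ∈ rootsOfUnity (Fintype.card Fˣ) EisensteinInt := by
    rw [mem_rootsOfUnity, hcu, pow_mul, Units.pow_ofPowEqOne, one_pow]
  set χ := MulChar.ofRootOfUnity hζ hα with hχdef
  have hχα : χ α = z := by
    rw [hχdef, MulChar.ofRootOfUnity_spec]; rfl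
  have hχ3 : χ ^ 3 = 1 := by
    rw [MulChar.eq_iff hα, MulChar.pow_apply_coe, hχα, hz3, MulChar.one_apply_coe]
  have hχ1 : χ ≠ 1 := by
    intro h
    apply hz1
    rw [← hχα, h, MulChar.one_apply_coe]
  have hφχ : ∀ x, φ (χ x) = x ^ M := by
    intro x
    rcases eq_or_ne x 0 with rfl | hx
    · rw [χ.map_zero, map_zero, zero_pow hM0]
    · obtain ⟨j, hj⟩ := Submonoid.mem_powers_iff _ _ |>.mp
        ((mem_powers_iff_mem_zpowers).mpr (hα (Units.mk0 x hx)))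
      have hx' : x = (α : F) ^ j := by
        rw [← Units.val_pow_eq_pow_val, hj, Units.val_mk0]
      rw [hx', map_pow, map_pow, hχα, hφz, pow_right_comm]
  have hJ := jacobiSum_self_eq_neg_pow hp hp3 hcard hM hM0 hχ3 hχ1 φ hφχ (π := ⟨a₀, b₀⟩)
    (by rw [QuadraticAlgebra.norm_def, hpab]; ring)
    (by
      rw [EisensteinInt.dvd_iff]
      simp only [QuadraticAlgebra.re_add, QuadraticAlgebra.im_add, QuadraticAlgebra.re_one,
        QuadraticAlgebra.im_one]
      omega)
    (by rw [hφ, EisensteinInt.evalHom_apply]; exact hγ) hb₀F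
  have hιstar : ∀ w, ι (star w) = starRingEnd ℂ (ι w) := by
    intro w
    rw [hι, EisensteinInt.evalHom_apply, EisensteinInt.evalHom_apply, map_add, map_mul, hωc]
    simp
    linear_combination -(w.im : ℂ) * hω
  have hιπ : ι ⟨a₀, b₀⟩ = a₀ + b₀ * ω := by rw [hι, EisensteinInt.evalHom_apply]
  have hιJ : ι (jacobiSum χ χ) = (-1) ^ (k + 1) * (a₀ + b₀ * ω) ^ k := by
    rw [hJ, map_mul, map_pow, map_pow, hιπ, map_neg, map_one]
  refine ⟨χ.ringHomComp ι, ?_, ?_, ?_, ?_⟩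
  · rw [MulChar.ringHomComp_pow, hχ3, MulChar.ringHomComp_one]
  · rw [MulChar.ringHomComp_apply, hχα, hιz]
  · rw [jacobiSum_ringHomComp, hιJ]
  · rw [MulChar.ringHomComp_inv, jacobiSum_ringHomComp, ← MulChar.ringHomComp_star_eq_inv hχ3,
      jacobiSum_ringHomComp, starRingEnd_apply, hιstar, hιJ]
    simp

end Jacobi

section CubicCosets

theorem sum_mulChar_mul_mulChar_mul_mulChar_add {F : Type*} [Field F] [Fintype F]
    (χ₁ χ₂ χ₃ : MulChar F ℂ) :
    ∑ x : F, ∑ y : F, χ₁ x * χ₂ y * χ₃ (x + y) =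
      (∑ w : F, (χ₁ * χ₂ * χ₃) w) * jacobiSum χ₁ χ₂ := by
  have h1 : ∀ x : F, ∑ y : F, χ₁ x * χ₂ y * χ₃ (x + y) =
      ∑ w : F, χ₁ x * χ₂ (w - x) * χ₃ w := by
    intro x
    refine Fintype.sum_equiv (Equiv.addLeft x) _ _ fun y => ?_
    simp
  simp_rw [h1]
  rw [Finset.sum_comm, Finset.sum_mul]
  refine Finset.sum_congr rfl fun w _ => ?_
  rcases eq_or_ne w 0 with rfl | hw
  · simp [MulChar.map_zero]
  · rw [jacobiSum, Finset.mul_sum]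
    refine (Fintype.sum_equiv (Equiv.mulLeft₀ w hw) _ _ fun t => ?_).symm
    have : w - w * t = w * (1 - t) := by ring
    simp only [Equiv.mulLeft₀_apply, MulChar.mul_apply, this, map_mul]
    ring

variable {F : Type*} [Field F]

/-- The indicator function of the level set of `χ` at `z`. -/
noncomputable def MulChar.levelInd (χ : MulChar F ℂ) (z : ℂ) (x : F) : ℂ :=
  if χ x = z then 1 else 0

variable {χ : MulChar F ℂ}

theorem MulChar.apply_pow_three_eq_one (hχ : χ ^ 3 = 1) {x : F} (hx : x ≠ 0) : χ x ^ 3 = 1 := by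
  rw [← MulChar.pow_apply' _ (by norm_num), hχ, MulChar.one_apply (Ne.isUnit hx)]

theorem MulChar.inv_eq_sq (hχ : χ ^ 3 = 1) : χ⁻¹ = χ ^ 2 := by
  rw [inv_eq_iff_mul_eq_one, ← pow_succ', hχ]

theorem MulChar.levelInd_eq (hχ : χ ^ 3 = 1) {z : ℂ} (hz : z ^ 3 = 1) (x : F) :
    χ.levelInd z x =
      1 / 3 * ∑ i : Fin 3, ![1, z ^ 2, z] i * (![1, χ, χ⁻¹] : Fin 3 → MulChar F ℂ) i x := by
  rw [Fin.sum_univ_three]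
  simp only [Matrix.cons_val]
  have hz0 : z ≠ 0 := by rintro rfl; norm_num at hz
  rcases eq_or_ne x 0 with rfl | hx
  · simp [MulChar.levelInd, hz0.symm]
  · have h3 := MulChar.apply_pow_three_eq_one hχ hx
    rw [MulChar.levelInd, MulChar.inv_eq_sq hχ, MulChar.pow_apply' _ two_ne_zero,
      MulChar.one_apply (Ne.isUnit hx)]
    split_ifs with h
    · rw [h]; linear_combination (-2 / 3) * hz
    · have : (χ x - z) * (χ x ^ 2 + χ x * z + z ^ 2) = 0 := by linear_combination h3 - hz
      have h5 := (mul_eq_zero.mp this).resolve_left (sub_ne_zero.mpr h)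
      linear_combination (-1 / 3) * z * h5 + (1 / 3) * hz

theorem MulChar.apply_eq_pow {u : ℂ} (hu : u ^ 2 + u + 1 = 0) (hχ : χ ^ 3 = 1) {x : F}
    (hx : x ≠ 0) : χ x = u ^ 0 ∨ χ x = u ^ 1 ∨ χ x = u ^ 2 := by
  have h3 := MulChar.apply_pow_three_eq_one hχ hx
  have h4 : (χ x - 1) * ((χ x - u) * (χ x - u ^ 2)) = 0 := by
    linear_combination h3 + (χ x - χ x ^ 2 + (χ x - 1) * (u - 1)) * hu
  rcases mul_eq_zero.mp h4 with h | h
  · left; simpa using sub_eq_zero.mp h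
  rcases mul_eq_zero.mp h with h | h
  · right; left; simpa using sub_eq_zero.mp h
  · right; right; simpa using sub_eq_zero.mp h

theorem MulChar.sum_levelInd_mul_apply {u : ℂ} (hu : u ^ 2 + u + 1 = 0) (hχ : χ ^ 3 = 1) (x : F)
    (f : ℂ → ℂ) :
    ∑ i : Fin 3, χ.levelInd (u ^ (i : ℕ)) x * f (u ^ (i : ℕ)) = if x = 0 then 0 else f (χ x) := by
  have hu0 : u ≠ 0 := by rintro rfl; norm_num at hu
  have hu1 : u ≠ 1 := by rintro rfl; norm_num at hu
  have hu3 : u ^ 2 ≠ 1 := by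
    intro h; apply hu1
    have h3 : u ^ 3 = 1 := by linear_combination (u - 1) * hu
    linear_combination h3 - u * h
  have hu2 : u ^ 2 ≠ u := by
    intro h; apply hu1
    exact mul_left_cancel₀ hu0 (by linear_combination h)
  simp only [Fin.sum_univ_three, MulChar.levelInd]
  by_cases h : x = 0
  · subst h
    simp [hu0.symm, (pow_ne_zero 2 hu0).symm]
  · rw [if_neg h]
    rcases MulChar.apply_eq_pow hu hχ h with h | h | h <;> rw [h] <;>
      simp [hu1, hu3, hu2, hu1.symm, hu3.symm, hu2.symm]

variable [Fintype F]

theorem MulChar.sum_levelInd (hχ : χ ^ 3 = 1) (h1 : χ ≠ 1) {z : ℂ} (hz : z ^ 3 = 1) :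
    ∑ x : F, χ.levelInd z x = ((Fintype.card F : ℂ) - 1) / 3 := by
  simp_rw [MulChar.levelInd_eq hχ hz, Fin.sum_univ_three]
  simp only [Matrix.cons_val]
  rw [← Finset.mul_sum, Finset.sum_add_distrib, Finset.sum_add_distrib, ← Finset.mul_sum,
    ← Finset.mul_sum, ← Finset.mul_sum, MulChar.sum_eq_zero_of_ne_one h1,
    MulChar.sum_eq_zero_of_ne_one (inv_ne_one.mpr h1), MulChar.sum_one_eq_card_units,
    Fintype.card_units, Nat.cast_sub Fintype.card_pos]
  push_cast
  ring

theorem MulChar.sum_levelInd_mul_levelInd_mul_levelInd_add (hχ : χ ^ 3 = 1) (h1 : χ ≠ 1)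
    {z₀ z₁ z₂ : ℂ} (hz₀ : z₀ ^ 3 = 1) (hz₁ : z₁ ^ 3 = 1) (hz₂ : z₂ ^ 3 = 1) :
    ∑ x : F, ∑ y : F, χ.levelInd z₀ x * χ.levelInd z₁ y * χ.levelInd z₂ (x + y) =
      ((Fintype.card F : ℂ) - 1) / 27 * (Fintype.card F - 2 +
        (z₀ * z₁ * z₂) ^ 2 * jacobiSum χ χ + z₀ * z₁ * z₂ * jacobiSum χ⁻¹ χ⁻¹ -
        (z₀ ^ 2 * z₁ + z₀ ^ 2 * z₂ + z₁ ^ 2 * z₀ + z₁ ^ 2 * z₂ + z₂ ^ 2 * z₀ + z₂ ^ 2 * z₁)) := by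
  have hexp : ∑ x : F, ∑ y : F, χ.levelInd z₀ x * χ.levelInd z₁ y * χ.levelInd z₂ (x + y) =
      1 / 27 * ∑ i : Fin 3, ∑ j : Fin 3, ∑ l : Fin 3,
        ![1, z₀ ^ 2, z₀] i * ![1, z₁ ^ 2, z₁] j * ![1, z₂ ^ 2, z₂] l *
        ∑ x : F, ∑ y : F, (![1, χ, χ⁻¹] : Fin 3 → MulChar F ℂ) i x *
          (![1, χ, χ⁻¹] : Fin 3 → MulChar F ℂ) j y *
          (![1, χ, χ⁻¹] : Fin 3 → MulChar F ℂ) l (x + y) := by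
    simp only [Fin.sum_univ_three, Finset.mul_sum, ← Finset.sum_add_distrib]
    refine Finset.sum_congr rfl fun x _ => Finset.sum_congr rfl fun y _ => ?_
    rw [MulChar.levelInd_eq hχ hz₀, MulChar.levelInd_eq hχ hz₁, MulChar.levelInd_eq hχ hz₂]
    simp only [Fin.sum_univ_three]
    ring
  have h1' : χ⁻¹ ≠ 1 := inv_ne_one.mpr h1
  have hsq : χ * χ = χ⁻¹ := by rw [MulChar.inv_eq_sq hχ, pow_two]
  have hsq' : χ⁻¹ * χ⁻¹ = χ := by rw [← mul_inv, hsq, inv_inv]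
  have hneg : χ (-1) = 1 := by
    have h := MulChar.apply_pow_three_eq_one hχ (x := -1) (by simp)
    rw [← map_pow] at h
    simpa [Odd.neg_one_pow (n := 3) (by decide)] using h
  have hneg' : χ⁻¹ (-1) = 1 := by
    rw [MulChar.inv_eq_sq hχ, MulChar.pow_apply' _ two_ne_zero, hneg, one_pow]
  have hcard : ∑ w : F, (1 : MulChar F ℂ) w = (Fintype.card F : ℂ) - 1 := by
    rw [MulChar.sum_one_eq_card_units, Fintype.card_units, Nat.cast_sub Fintype.card_pos]
    simp
  have hs := MulChar.sum_eq_zero_of_ne_one h1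
  have hs' := MulChar.sum_eq_zero_of_ne_one h1'
  have J1 : jacobiSum χ χ⁻¹ = -1 := by rw [jacobiSum_nontrivial_inv h1, hneg]
  have J1' : jacobiSum χ⁻¹ χ = -1 := by rw [jacobiSum_comm, J1]
  have J2 := jacobiSum_one_nontrivial h1
  have J2' := jacobiSum_one_nontrivial h1'
  have J3 : jacobiSum χ 1 = -1 := by rw [jacobiSum_comm, J2]
  have J3' : jacobiSum χ⁻¹ 1 = -1 := by rw [jacobiSum_comm, J2']
  have J0 : jacobiSum (1 : MulChar F ℂ) 1 = Fintype.card F - 2 := jacobiSum_one_one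
  rw [hexp]
  simp only [sum_mulChar_mul_mulChar_mul_mulChar_add, Fin.sum_univ_three, Matrix.cons_val, one_mul,
    mul_one, hsq, hsq', mul_inv_cancel, inv_mul_cancel, hcard, hs, hs', J1, J1', J2, J2', J3, J3',
    J0, zero_mul, mul_zero, add_zero, zero_add]
  ring

theorem MulChar.sum_comp_apply {u : ℂ} (hu : u ^ 2 + u + 1 = 0) (hχ : χ ^ 3 = 1) (h1 : χ ≠ 1)
    (f : ℂ → ℂ) :
    ∑ x : F, f (χ x) = f 0 + ((Fintype.card F : ℂ) - 1) / 3 * ∑ i : Fin 3, f (u ^ (i : ℕ)) := by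
  have hu3 : ∀ i : ℕ, (u ^ i) ^ 3 = 1 := by
    intro i
    rw [pow_right_comm, show u ^ 3 = 1 by linear_combination (u - 1) * hu, one_pow]
  have h2 : ∀ x : F, f (χ x) = (if x = 0 then f 0 else 0) +
      ∑ i : Fin 3, χ.levelInd (u ^ (i : ℕ)) x * f (u ^ (i : ℕ)) := by
    intro x
    rw [MulChar.sum_levelInd_mul_apply hu hχ]
    split_ifs with h
    · rw [h, χ.map_zero, add_zero]
    · rw [zero_add]
  simp_rw [h2]
  rw [Finset.sum_add_distrib, Finset.sum_ite_eq' Finset.univ (0 : F), if_pos (Finset.mem_univ _),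
    Finset.sum_comm, Finset.mul_sum]
  congr 1
  refine Finset.sum_congr rfl fun i _ => ?_
  rw [← Finset.sum_mul, MulChar.sum_levelInd hχ h1 (hu3 i)]

theorem MulChar.sum_comp_apply_add {u : ℂ} (hu : u ^ 2 + u + 1 = 0) (hχ : χ ^ 3 = 1) (h1 : χ ≠ 1)
    (H : ℂ → ℂ → ℂ → ℂ) :
    ∑ x : F, ∑ y : F, H (χ x) (χ y) (χ (x + y)) = H 0 0 0 +
      ((Fintype.card F : ℂ) - 1) / 3 * ∑ i : Fin 3, (H 0 (u ^ (i : ℕ)) (u ^ (i : ℕ)) +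
        H (u ^ (i : ℕ)) 0 (u ^ (i : ℕ)) + H (u ^ (i : ℕ)) (u ^ (i : ℕ)) 0) +
      ∑ i : Fin 3, ∑ j : Fin 3, ∑ l : Fin 3, (∑ x : F, ∑ y : F, χ.levelInd (u ^ (i : ℕ)) x *
        χ.levelInd (u ^ (j : ℕ)) y * χ.levelInd (u ^ (l : ℕ)) (x + y)) *
        H (u ^ (i : ℕ)) (u ^ (j : ℕ)) (u ^ (l : ℕ)) := by
  have hneg : ∀ x, χ (-x) = χ x := by
    intro x
    have h := MulChar.apply_pow_three_eq_one hχ (x := -1) (by simp)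
    rw [← map_pow, Odd.neg_one_pow (n := 3) (by decide)] at h
    rw [neg_eq_neg_one_mul, map_mul, h, one_mul]
  have h2 : ∀ x y : F, H (χ x) (χ y) (χ (x + y)) =
      (∑ i : Fin 3, χ.levelInd (u ^ (i : ℕ)) x * ∑ j : Fin 3, χ.levelInd (u ^ (j : ℕ)) y *
        ∑ l : Fin 3, χ.levelInd (u ^ (l : ℕ)) (x + y) *
          H (u ^ (i : ℕ)) (u ^ (j : ℕ)) (u ^ (l : ℕ))) +
      (if x = 0 then H 0 (χ y) (χ y) else 0) + (if y = 0 then H (χ x) 0 (χ x) else 0) +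
      (if y = -x then H (χ x) (χ x) 0 else 0) -
      (if x = 0 then if y = 0 then 2 * H 0 0 0 else 0 else 0) := by
    intro x y
    rw [MulChar.sum_levelInd_mul_apply hu hχ x fun z => ∑ j : Fin 3,
      χ.levelInd (u ^ (j : ℕ)) y * ∑ l : Fin 3, χ.levelInd (u ^ (l : ℕ)) (x + y) *
          H z (u ^ (j : ℕ)) (u ^ (l : ℕ)),
      MulChar.sum_levelInd_mul_apply hu hχ y fun z => ∑ l : Fin 3,
        χ.levelInd (u ^ (l : ℕ)) (x + y) * H (χ x) z (u ^ (l : ℕ)),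
      MulChar.sum_levelInd_mul_apply hu hχ (x + y) fun z => H (χ x) (χ y) z]
    rcases eq_or_ne x 0 with rfl | hx
    · rcases eq_or_ne y 0 with rfl | hy
      · simp; ring
      · simp [hy]
    · rcases eq_or_ne y 0 with rfl | hy
      · simp [hx, eq_comm (a := (0 : F))]
      · rcases eq_or_ne y (-x) with rfl | hxy
        · simp [hx, hneg]
        · have : x + y ≠ 0 := fun h => hxy (by linear_combination h)
          simp [hx, hy, hxy, this]
  simp_rw [h2]
  simp only [Finset.sum_sub_distrib, Finset.sum_add_distrib]
  have e1 : ∑ x : F, ∑ y : F, (if x = 0 then H 0 (χ y) (χ y) else 0) =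
      ∑ y : F, H 0 (χ y) (χ y) := by
    rw [Finset.sum_comm]; simp
  have e2 : ∑ x : F, ∑ y : F, (if y = 0 then H (χ x) 0 (χ x) else 0) =
      ∑ x : F, H (χ x) 0 (χ x) := by simp
  have e3 : ∑ x : F, ∑ y : F, (if y = -x then H (χ x) (χ x) 0 else 0) =
      ∑ x : F, H (χ x) (χ x) 0 := by simp
  have e4 : ∑ x : F, ∑ y : F, (if x = 0 then if y = 0 then 2 * H 0 0 0 else 0 else 0) =
      2 * H 0 0 0 := by
    rw [Finset.sum_comm]; simp
  rw [e1, e2, e3, e4, MulChar.sum_comp_apply hu hχ h1 fun z => H 0 z z,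
    MulChar.sum_comp_apply hu hχ h1 fun z => H z 0 z,
    MulChar.sum_comp_apply hu hχ h1 fun z => H z z 0]
  have e5 : ∑ x : F, ∑ y : F, ∑ i : Fin 3, χ.levelInd (u ^ (i : ℕ)) x *
        ∑ j : Fin 3, χ.levelInd (u ^ (j : ℕ)) y *
        ∑ l : Fin 3, χ.levelInd (u ^ (l : ℕ)) (x + y) *
          H (u ^ (i : ℕ)) (u ^ (j : ℕ)) (u ^ (l : ℕ)) =
      ∑ i : Fin 3, ∑ j : Fin 3, ∑ l : Fin 3, (∑ x : F, ∑ y : F, χ.levelInd (u ^ (i : ℕ)) x *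
        χ.levelInd (u ^ (j : ℕ)) y * χ.levelInd (u ^ (l : ℕ)) (x + y)) *
        H (u ^ (i : ℕ)) (u ^ (j : ℕ)) (u ^ (l : ℕ)) := by
    simp only [Fin.sum_univ_three, Finset.sum_mul, ← Finset.sum_add_distrib]
    refine Finset.sum_congr rfl fun x _ => Finset.sum_congr rfl fun y _ => ?_
    ring
  rw [e5]
  simp only [Fin.sum_univ_three]
  ring

end CubicCosets

section TracePeriods

/-- The cubic Gaussian period `∑ ψ (z u)`, over the nonzero cubes `z`. -/
noncomputable def cubicPeriod {F : Type*} [Field F] [Fintype F] (ψ : F → ℂ) (u : F) : ℂ :=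
  ∑ z ∈ Finset.univ.filter (fun x : F => x ≠ 0 ∧ ∃ y : F, y ^ 3 = x), ψ (z * u)

/-- A function on a field invariant under two multiplications is invariant under
multiplication by the power given by the gcd of the exponents. -/
lemma apply_pow_gcd_mul {F : Type*} [Field F] {α : Fˣ} {S : F → ℂ} {R E : ℕ}
    (hR : ∀ v, S ((α : F) ^ R * v) = S v) (hE : ∀ v, S ((α : F) ^ E * v) = S v) (v : F) :
    S ((α : F) ^ Nat.gcd R E * v) = S v := by
  let G : Subgroup Fˣ :=
    { carrier := {t | ∀ v, S ((t : F) * v) = S v}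
      one_mem' := by simp
      mul_mem' := by
        intro a b ha hb v
        rw [Units.val_mul, mul_assoc, ha, hb]
      inv_mem' := by
        intro a ha v
        rw [← ha, Units.mul_inv_cancel_left] }
  have h1 : α ^ R ∈ G := fun v => by simpa using hR v
  have h2 : α ^ E ∈ G := fun v => by simpa using hE v
  have h3 : α ^ Nat.gcd R E ∈ G := by
    rw [← zpow_natCast, Nat.gcd_eq_gcd_ab, zpow_add, zpow_mul, zpow_mul]
    exact mul_mem (zpow_mem (by simpa using h1) _) (zpow_mem (by simpa using h2) _)
  simpa using h3 v

variable {F : Type*} [Field F] [Fintype F]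

lemma cubicPeriod_mul_cube (ψ : F → ℂ) {c : F} (hc : c ≠ 0) (u : F) :
    cubicPeriod ψ (c ^ 3 * u) = cubicPeriod ψ u := by
  unfold cubicPeriod
  refine Finset.sum_bij' (fun z _ => z * c ^ 3) (fun z _ => z * (c⁻¹) ^ 3) ?_ ?_ ?_ ?_ ?_
  · rintro z hz
    simp only [Finset.mem_filter, Finset.mem_univ, true_and] at hz ⊢
    obtain ⟨hz, y, rfl⟩ := hz
    exact ⟨mul_ne_zero hz (pow_ne_zero _ hc), y * c, by ring⟩
  · rintro z hz
    simp only [Finset.mem_filter, Finset.mem_univ, true_and] at hz ⊢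
    obtain ⟨hz, y, rfl⟩ := hz
    exact ⟨mul_ne_zero hz (pow_ne_zero _ (inv_ne_zero hc)), y * c⁻¹, by ring⟩
  · intro z _
    field_simp
  · intro z _
    field_simp
  · intro z _
    ring_nf

lemma orderOf_generator {α : Fˣ} (hα : ∀ x : Fˣ, x ∈ Subgroup.zpowers α) :
    orderOf α = Fintype.card F - 1 := by
  rw [orderOf_eq_card_of_forall_mem_zpowers hα, Nat.card_eq_fintype_card, Fintype.card_units]

lemma exists_pow_eq_of_ne_zero {α : Fˣ} (hα : ∀ x : Fˣ, x ∈ Subgroup.zpowers α) {x : F}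
    (hx : x ≠ 0) : ∃ i : ℕ, x = (α : F) ^ i := by
  obtain ⟨i, hi⟩ := (mem_powers_iff_mem_zpowers).mpr (hα (Units.mk0 x hx))
  exact ⟨i, by simpa using (congrArg Units.val hi).symm⟩

/-- The nonzero cubes are the powers `α ^ (3 i)`, `i < M`, where `3 M = |F| - 1`. -/
lemma sum_cubes_eq_sum_range {α : Fˣ} (hα : ∀ x : Fˣ, x ∈ Subgroup.zpowers α) {M : ℕ}
    (hM : 3 * M + 1 = Fintype.card F) (f : F → ℂ) :
    ∑ z ∈ Finset.univ.filter (fun x : F => x ≠ 0 ∧ ∃ y : F, y ^ 3 = x), f z =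
      ∑ i ∈ Finset.range M, f ((α : F) ^ (3 * i)) := by
  have ho : orderOf α = 3 * M := by rw [orderOf_generator hα]; omega
  symm
  refine Finset.sum_bij (fun i _ => (α : F) ^ (3 * i)) ?_ ?_ ?_ ?_
  · intro i _
    simp only [Finset.mem_filter, Finset.mem_univ, true_and]
    exact ⟨pow_ne_zero _ α.ne_zero, (α : F) ^ i, by ring⟩
  · intro i hi j hj hij
    rw [Finset.mem_range] at hi hj
    have h' : α ^ (3 * i) = α ^ (3 * j) := by ext; simpa using hij
    have := pow_injOn_Iio_orderOf (x := α) (by simp; omega) (by simp; omega) h'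
    omega
  · intro z hz
    simp only [Finset.mem_filter, Finset.mem_univ, true_and] at hz
    obtain ⟨hz, y, rfl⟩ := hz
    obtain ⟨i, rfl⟩ := exists_pow_eq_of_ne_zero hα (x := y) (by rintro rfl; simp at hz)
    have hM0 : 0 < M := by
      have := Fintype.one_lt_card (α := F)
      omega
    refine ⟨i % M, Finset.mem_range.mpr (Nat.mod_lt _ hM0), ?_⟩
    have : α ^ (3 * (i % M)) = α ^ (i * 3) := by
      rw [pow_eq_pow_iff_modEq, ho, mul_comm i 3]
      exact (Nat.mod_modEq i M).mul_left' 3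
    rw [← pow_mul]
    simpa using congrArg Units.val this
  · intro i _
    rfl

variable {K : Type*} [Field K] [Fintype K] [Algebra K F]

/-- Exponent of the norm map: powers of `α ^ ((r - 1) / (q - 1))` lie in the base field. -/
lemma exists_unit_algebraMap_eq_pow (α : Fˣ) {R : ℕ}
    (hR : (Fintype.card K - 1) * R = Fintype.card F - 1) :
    ∃ c : Kˣ, algebraMap K F c = (α : F) ^ R := by
  have hq : 1 < Fintype.card K := Fintype.one_lt_card
  refine ⟨Units.map (Algebra.norm K) α, ?_⟩
  have h2 := FiniteField.algebraMap_norm_eq_pow (K := K) (K' := F) (x := (α : F))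
  rw [Units.coe_map]
  refine h2.trans ?_
  congr 1
  rw [Nat.card_eq_fintype_card, Nat.card_eq_fintype_card, ← hR]
  exact Nat.mul_div_cancel_left _ (by omega)

lemma sum_units_sum_range_eq_cubicPeriod {α : Fˣ} (hα : ∀ x : Fˣ, x ∈ Subgroup.zpowers α)
    (ψ : F → ℂ) {d h R M n : ℕ} (hM : 3 * M + 1 = Fintype.card F)
    (hR : (Fintype.card K - 1) * R = Fintype.card F - 1) (h3R : 3 ∣ R)
    (hd : d * h = Fintype.card K - 1) (hgcd : Nat.gcd R (3 * d) = 3) (hn : 3 * n = h * R)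
    (v : F) :
    ∑ y : Kˣ, ∑ k ∈ Finset.range n, ψ (algebraMap K F y * (α : F) ^ (3 * d * k) * v) =
      h * cubicPeriod ψ v := by
  have ho : orderOf α = Fintype.card F - 1 := orderOf_generator hα
  have hq : 1 < Fintype.card K := Fintype.one_lt_card
  have hM0 : 0 < M := by
    have := Fintype.one_lt_card (α := F)
    omega
  set S : F → ℂ := fun v =>
    ∑ y : Kˣ, ∑ k ∈ Finset.range n, ψ (algebraMap K F y * (α : F) ^ (3 * d * k) * v) with hS
  have hαcube : ∀ y : Kˣ, ∃ c : F, c ≠ 0 ∧ algebraMap K F y = c ^ 3 := by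
    intro y
    obtain ⟨i, hi⟩ := exists_pow_eq_of_ne_zero hα (x := algebraMap K F y) (by simp)
    have h1 : α ^ (i * (Fintype.card K - 1)) = 1 := by
      ext
      rw [Units.val_pow_eq_pow_val, pow_mul, ← hi, ← map_pow, FiniteField.pow_card_sub_one_eq_one _ y.ne_zero]
      simp
    have h2 := orderOf_dvd_of_pow_eq_one h1
    rw [ho, ← hR, mul_comm] at h2
    have h3 : R ∣ i := Nat.dvd_of_mul_dvd_mul_right (by omega) h2
    obtain ⟨j, rfl⟩ := h3R.trans h3
    exact ⟨(α : F) ^ j, pow_ne_zero _ α.ne_zero, by rw [hi]; ring⟩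
  have hS1 : ∀ v, S ((α : F) ^ R * v) = S v := by
    intro v
    obtain ⟨c, hc⟩ := exists_unit_algebraMap_eq_pow (K := K) α hR
    simp only [hS]
    rw [← Equiv.sum_comp (Equiv.mulLeft c) (fun y : Kˣ => ∑ k ∈ Finset.range n,
      ψ (algebraMap K F y * (α : F) ^ (3 * d * k) * v))]
    refine Finset.sum_congr rfl fun y _ => Finset.sum_congr rfl fun k _ => ?_
    rw [← hc]
    simp only [Equiv.coe_mulLeft, Units.val_mul, map_mul]
    congr 1
    ring
  have hS2 : ∀ v, S ((α : F) ^ (3 * d) * v) = S v := by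
    intro v
    simp only [hS]
    refine Finset.sum_congr rfl fun y _ => ?_
    set f : ℕ → ℂ := fun k => ψ (algebraMap K F y * (α : F) ^ (3 * d * k) * v) with hf
    have h1 : f n = f 0 := by
      have : α ^ (3 * d * n) = 1 := by
        rw [show 3 * d * n = (Fintype.card F - 1) * 1 by
          rw [← hR, ← hd]; calc 3 * d * n = d * (3 * n) := by ring
            _ = _ := by rw [hn]; ring, pow_mul, ← ho, pow_orderOf_eq_one, one_pow]
      have := congrArg Units.val this
      simp only [Units.val_pow_eq_pow_val, Units.val_one] at this
      simp [hf, this]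
    calc ∑ k ∈ Finset.range n,
          ψ (algebraMap K F y * (α : F) ^ (3 * d * k) * ((α : F) ^ (3 * d) * v))
        = ∑ k ∈ Finset.range n, f (k + 1) := by
          refine Finset.sum_congr rfl fun k _ => ?_
          simp only [hf]
          congr 1
          ring
      _ = ∑ k ∈ Finset.range n, f k := by
          have h2 := Finset.sum_range_succ f n
          rw [Finset.sum_range_succ', h1] at h2
          exact add_right_cancel h2
  have hS3 : ∀ v, S ((α : F) ^ 3 * v) = S v := fun v => by
    simpa only [hgcd] using apply_pow_gcd_mul hS1 hS2 v
  have hS4 : ∀ i v, S ((α : F) ^ (3 * i) * v) = S v := by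
    intro i v
    induction i with
    | zero => simp
    | succ i ih =>
      rw [show (α : F) ^ (3 * (i + 1)) * v = (α : F) ^ 3 * ((α : F) ^ (3 * i) * v) by ring, hS3, ih]
  have hperiod : ∀ v, cubicPeriod ψ v = ∑ i ∈ Finset.range M, ψ ((α : F) ^ (3 * i) * v) :=
    fun v => sum_cubes_eq_sum_range hα hM fun z => ψ (z * v)
  have key : (M : ℂ) * S v = (Fintype.card Kˣ * n : ℕ) * cubicPeriod ψ v := by
    calc (M : ℂ) * S v = ∑ i ∈ Finset.range M, S ((α : F) ^ (3 * i) * v) := by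
          simp [hS4]
      _ = ∑ y : Kˣ, ∑ k ∈ Finset.range n, ∑ i ∈ Finset.range M,
            ψ ((α : F) ^ (3 * i) * (algebraMap K F y * (α : F) ^ (3 * d * k) * v)) := by
          simp only [hS]
          rw [Finset.sum_comm]
          refine Finset.sum_congr rfl fun y _ => ?_
          rw [Finset.sum_comm]
          refine Finset.sum_congr rfl fun k _ => Finset.sum_congr rfl fun i _ => ?_
          congr 1
          ring
      _ = ∑ y : Kˣ, ∑ k ∈ Finset.range n, cubicPeriod ψ v := by
          refine Finset.sum_congr rfl fun y _ => Finset.sum_congr rfl fun k _ => ?_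
          rw [← hperiod]
          obtain ⟨c, hc, hy⟩ := hαcube y
          rw [hy, show c ^ 3 * (α : F) ^ (3 * d * k) * v = (c * (α : F) ^ (d * k)) ^ 3 * v by ring]
          exact cubicPeriod_mul_cube ψ (mul_ne_zero hc (pow_ne_zero _ α.ne_zero)) v
      _ = _ := by
          simp [mul_assoc]
  have hcount : Fintype.card Kˣ * n = h * M := by
    rw [Fintype.card_units]
    have h1 : (Fintype.card K - 1) * (3 * n) = h * (3 * M) := by
      rw [hn, show 3 * M = Fintype.card F - 1 by omega, ← hR]
      ring
    have h2 : 3 * ((Fintype.card K - 1) * n) = 3 * (h * M) := by linarith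
    omega
  rw [hcount] at key
  push_cast at key
  have hMC : (M : ℂ) ≠ 0 := by exact_mod_cast hM0.ne'
  refine mul_left_cancel₀ hMC ?_
  show (M : ℂ) * S v = _
  rw [key]
  ring

/-- The canonical additive character of a finite field of characteristic `p`. -/
noncomputable def traceChar (p : ℕ) [NeZero p] (F : Type*) [Field F] [Algebra (ZMod p) F] :
    AddChar F ℂ :=
  (ZMod.stdAddChar (N := p)).compAddMonoidHom (Algebra.trace (ZMod p) F).toAddMonoidHom

lemma traceChar_apply (p : ℕ) [NeZero p] (F : Type*) [Field F] [Algebra (ZMod p) F] (x : F) :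
    traceChar p F x = ZMod.stdAddChar (Algebra.trace (ZMod p) F x) :=
  rfl

lemma traceChar_eq_exp (p : ℕ) [NeZero p] (F : Type*) [Field F] [Algebra (ZMod p) F] (x : F) :
    traceChar p F x = Complex.exp (2 * Real.pi * Complex.I *
      (ZMod.val (Algebra.trace (ZMod p) F x)) / p) := by
  rw [traceChar_apply, ZMod.stdAddChar_apply, ZMod.toCircle_apply]

lemma traceChar_isPrimitive (p : ℕ) [Fact p.Prime] (F : Type*) [Field F] [Finite F]
    [Algebra (ZMod p) F] : (traceChar p F).IsPrimitive := by
  refine AddChar.IsPrimitive.of_ne_one (AddChar.ne_one_iff.mpr ?_)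
  obtain ⟨x, hx⟩ := Algebra.trace_surjective (ZMod p) F 1
  refine ⟨x, fun h => ?_⟩
  rw [traceChar_apply, hx] at h
  have h0 := ZMod.injective_stdAddChar (h.trans (AddChar.map_zero_eq_one _).symm)
  exact one_ne_zero h0

/-- The canonical character detects the vanishing of the relative trace. -/
lemma sum_traceChar_algebraMap_mul (p : ℕ) [Fact p.Prime] [Algebra (ZMod p) F] (z : F) :
    ∑ y : K, traceChar p F (algebraMap K F y * z) =
      if Algebra.trace K F z = 0 then (Fintype.card K : ℂ) else 0 := by
  have : CharP F p := charP_of_injective_algebraMap (algebraMap (ZMod p) F).injective p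
  have : CharP K p := ((algebraMap K F).charP_iff (algebraMap K F).injective p).mpr inferInstance
  let _ : Algebra (ZMod p) K := ZMod.algebra K p
  have : IsScalarTower (ZMod p) K F := IsScalarTower.of_algebraMap_eq' (Subsingleton.elim _ _)
  have h1 : ∀ y : K, traceChar p F (algebraMap K F y * z) =
      traceChar p K (y * Algebra.trace K F z) := by
    intro y
    rw [traceChar_apply, traceChar_apply, ← Algebra.trace_trace (S := K), ← Algebra.smul_def,
      map_smul, smul_eq_mul]
  simp only [h1]
  rw [AddChar.sum_mulShift _ (traceChar_isPrimitive p K)]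
  split_ifs <;> simp

end TracePeriods

section ModifiedWeight

lemma sum_range_three_mul (f : ℕ → ℂ) (n : ℕ) :
    ∑ i ∈ Finset.range (3 * n), f i =
      ∑ k ∈ Finset.range n, (f (3 * k) + f (3 * k + 1) + f (3 * k + 2)) := by
  induction n with
  | zero => simp
  | succ n ih =>
    rw [Finset.sum_range_succ, ← ih, mul_add, mul_one, Finset.sum_range_succ,
      Finset.sum_range_succ, Finset.sum_range_succ]
    ring

lemma sum_eq_apply_zero_add_sum_units {K : Type*} [Field K] [Fintype K] (f : K → ℂ) :
    ∑ y : K, f y = f 0 + ∑ y : Kˣ, f y := by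
  rw [← Finset.add_sum_erase _ _ (Finset.mem_univ (0 : K))]
  congr 1
  refine (Finset.sum_bij (fun (y : Kˣ) _ => (y : K)) ?_ ?_ ?_ ?_).symm
  · intro y _
    simp
  · intro y _ z _ h
    exact Units.ext h
  · intro y hy
    exact ⟨Units.mk0 y (Finset.ne_of_mem_erase hy), Finset.mem_univ _, rfl⟩
  · intro y _
    rfl

/-- The modified weight of a codeword, as a sum of three cubic Gaussian periods. -/
lemma modifiedWeight_eq_sum_cubicPeriod {F K : Type*} [Field F] [Fintype F] [Field K]
    [Fintype K] [Algebra K F] (p : ℕ) [Fact p.Prime] [Algebra (ZMod p) F]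
    {α : Fˣ} (hα : ∀ x : Fˣ, x ∈ Subgroup.zpowers α)
    {d h R M n : ℕ} (hM : 3 * M + 1 = Fintype.card F)
    (hR : (Fintype.card K - 1) * R = Fintype.card F - 1) (h3R : 3 ∣ R)
    (hd : d * h = Fintype.card K - 1) (hgcd : Nat.gcd R (3 * d) = 3) (hn : 3 * n = h * R)
    {β : F} (hβ : β ^ 3 = 1) (a b : F) :
    (h : ℂ) * ((Fintype.card F : ℂ) - 1) / Fintype.card K -
      (Set.ncard {i : Fin (3 * n) | Algebra.trace K F
        (a * ((α : F) ^ d) ^ (i : ℕ) + b * (β * (α : F) ^ d) ^ (i : ℕ)) ≠ 0} : ℂ) =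
    (h : ℂ) / Fintype.card K * (cubicPeriod (traceChar p F) (a + b) +
      cubicPeriod (traceChar p F) ((α : F) ^ d * (a + b * β)) +
      cubicPeriod (traceChar p F) ((α : F) ^ (2 * d) * (a + b * β ^ 2))) := by
  set ψ := traceChar p F
  set q := Fintype.card K
  set z : ℕ → F := fun i => a * ((α : F) ^ d) ^ i + b * (β * (α : F) ^ d) ^ i with hz
  have hq1 : 1 < q := Fintype.one_lt_card
  have hq0 : (q : ℂ) ≠ 0 := by exact_mod_cast (by omega : q ≠ 0)
  have hcompl : (Set.ncard {i : Fin (3 * n) | Algebra.trace K F (z i) ≠ 0} : ℂ) =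
      ((3 * n : ℕ) : ℂ) -
        ∑ i ∈ Finset.range (3 * n), if Algebra.trace K F (z i) = 0 then (1 : ℂ) else 0 := by
    rw [Set.ncard_eq_toFinset_card', Finset.sum_range
      (fun i => if Algebra.trace K F (z i) = 0 then (1 : ℂ) else 0)]
    simp only [Set.toFinset_ofPred, ne_eq]
    have h1 := Finset.card_filter_add_card_filter_not (s := (Finset.univ : Finset (Fin (3 * n))))
      (fun i => Algebra.trace K F (z i) = 0)
    rw [Finset.card_univ, Fintype.card_fin] at h1
    rw [Finset.sum_boole, eq_sub_iff_add_eq']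
    convert congrArg (Nat.cast : ℕ → ℂ) h1 using 1
    push_cast
    congr!
  have hzeros : (q : ℂ) *
      (∑ i ∈ Finset.range (3 * n), if Algebra.trace K F (z i) = 0 then (1 : ℂ) else 0) =
      ((3 * n : ℕ) : ℂ) + ∑ i ∈ Finset.range (3 * n), ∑ y : Kˣ, ψ (algebraMap K F y * z i) := by
    have h1 : ∀ i, (q : ℂ) * (if Algebra.trace K F (z i) = 0 then (1 : ℂ) else 0) =
        1 + ∑ y : Kˣ, ψ (algebraMap K F y * z i) := by
      intro i
      have h2 := sum_traceChar_algebraMap_mul (K := K) p (z i)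
      rw [sum_eq_apply_zero_add_sum_units] at h2
      simp only [map_zero, zero_mul, AddChar.map_zero_eq_one] at h2
      rw [h2, mul_ite, mul_one, mul_zero]
    rw [Finset.mul_sum, Finset.sum_congr rfl fun i _ => h1 i, Finset.sum_add_distrib]
    simp
  have hβk : ∀ k, β ^ (3 * k) = 1 := fun k => by rw [pow_mul, hβ, one_pow]
  have hz0 : ∀ k, z (3 * k) = (α : F) ^ (3 * d * k) * (a + b) := by
    intro k
    simp only [hz, mul_pow, hβk]
    ring
  have hz1 : ∀ k, z (3 * k + 1) = (α : F) ^ (3 * d * k) * ((α : F) ^ d * (a + b * β)) := by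
    intro k
    simp only [hz, mul_pow, pow_add, hβk]
    ring
  have hz2 : ∀ k, z (3 * k + 2) =
      (α : F) ^ (3 * d * k) * ((α : F) ^ (2 * d) * (a + b * β ^ 2)) := by
    intro k
    simp only [hz, mul_pow, pow_add, hβk]
    ring
  have hperiod : ∀ v : F, ∑ k ∈ Finset.range n, ∑ y : Kˣ,
      ψ (algebraMap K F y * ((α : F) ^ (3 * d * k) * v)) = h * cubicPeriod ψ v := by
    intro v
    rw [Finset.sum_comm, ← sum_units_sum_range_eq_cubicPeriod (K := K) hα ψ hM hR h3R hd hgcd hn v]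
    simp only [mul_assoc]
  have hsum : ∑ i ∈ Finset.range (3 * n), ∑ y : Kˣ, ψ (algebraMap K F y * z i) =
      h * cubicPeriod ψ (a + b) + h * cubicPeriod ψ ((α : F) ^ d * (a + b * β)) +
        h * cubicPeriod ψ ((α : F) ^ (2 * d) * (a + b * β ^ 2)) := by
    rw [sum_range_three_mul]
    simp only [hz0, hz1, hz2, Finset.sum_add_distrib, hperiod]
  rw [hsum] at hzeros
  have hnq : ((3 * n : ℕ) : ℂ) * ((q : ℂ) - 1) = h * ((Fintype.card F : ℂ) - 1) := by
    have h1 : 3 * n * (q - 1) = h * (Fintype.card F - 1) := by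
      rw [hn, ← hR]
      ring
    have h2 : ((3 * n * (q - 1) : ℕ) : ℂ) = ((h * (Fintype.card F - 1) : ℕ) : ℂ) := by rw [h1]
    rw [Nat.cast_mul, Nat.cast_sub hq1.le, Nat.cast_mul h,
      Nat.cast_sub Fintype.one_lt_card.le] at h2
    simpa using h2
  rw [hcompl]
  push_cast at hzeros hnq ⊢
  field_simp
  linear_combination hzeros - hnq

end ModifiedWeight

section CubicCount

/-- Number of `(x, y)` with prescribed cubic residue classes `u ^ i`, `u ^ j`, `u ^ l` of
`x`, `y` and `x + y`, in terms of the Jacobi sums. -/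
lemma MulChar.sum_levelInd_pow {F : Type*} [Field F] [Fintype F] {u : ℂ} (hu : u ^ 2 + u + 1 = 0)
    {χ : MulChar F ℂ} (hχ : χ ^ 3 = 1) (h1 : χ ≠ 1) (i j l : Fin 3) :
    ∑ x, ∑ y, χ.levelInd (u ^ (i : ℕ)) x * χ.levelInd (u ^ (j : ℕ)) y *
      χ.levelInd (u ^ (l : ℕ)) (x + y) =
    ((Fintype.card F : ℂ) - 1) / 27 * (Fintype.card F - 2 +
      (u ^ (2 * (i + j + l : Fin 3) : ℕ) * jacobiSum χ χ +
        u ^ ((i + j + l : Fin 3) : ℕ) * jacobiSum χ⁻¹ χ⁻¹) -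
      if i = j then (if j = l then 6 else 0) else (if j = l ∨ i = l then 0 else -3)) := by
  have hu3 : u ^ 3 = 1 := by linear_combination (u - 1) * hu
  have hz : ∀ i : ℕ, (u ^ i) ^ 3 = 1 := fun i => by rw [← pow_mul, mul_comm, pow_mul, hu3, one_pow]
  rw [MulChar.sum_levelInd_mul_levelInd_mul_levelInd_add hχ h1 (hz i) (hz j) (hz l)]
  have hu2 : u ^ 2 = -1 - u := by linear_combination hu
  generalize jacobiSum χ χ = J
  generalize jacobiSum χ⁻¹ χ⁻¹ = J'
  have h4 : u ^ 4 = u := by linear_combination u * hu3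
  have h5 : u ^ 5 = -1 - u := by linear_combination u ^ 2 * hu3 + hu2
  have h6 : u ^ 6 = 1 := by linear_combination (u ^ 3 + 1) * hu3
  have h8 : u ^ 8 = -1 - u := by linear_combination u ^ 2 * h6 + hu2
  have h10 : u ^ 10 = u := by linear_combination u ^ 4 * h6 + h4
  have h12 : u ^ 12 = 1 := by linear_combination (u ^ 6 + 1) * h6
  congr 1
  fin_cases i <;> fin_cases j <;> fin_cases l <;>
    simp [-mul_eq_mul_left_iff] <;> ring_nf <;>
    simp only [hu2, hu3, h4, h5, h6, h8, h10, h12] <;> ring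

/-- The function with values `e₀`, `e₁`, `e₂`, `e₃` at `0`, `1`, `u`, `u ^ 2`. -/
noncomputable def cubicValue (u e₀ e₁ e₂ e₃ z : ℂ) : ℂ :=
  if z = 0 then e₀ else if z = 1 then e₁ else if z = u then e₂ else e₃

variable {u : ℂ} (e₀ e₁ e₂ e₃ : ℂ)

@[simp]
lemma cubicValue_zero : cubicValue u e₀ e₁ e₂ e₃ 0 = e₀ := by
  simp [cubicValue]

@[simp]
lemma cubicValue_one : cubicValue u e₀ e₁ e₂ e₃ 1 = e₁ := by
  simp [cubicValue]

lemma ne_one_of_sq_add_self_add_one_eq_zero {u : ℂ} (hu : u ^ 2 + u + 1 = 0) : u ≠ 1 := by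
  rintro rfl
  norm_num at hu

lemma ne_zero_of_sq_add_self_add_one_eq_zero {u : ℂ} (hu : u ^ 2 + u + 1 = 0) : u ≠ 0 := by
  rintro rfl
  norm_num at hu

lemma cubicValue_self (hu : u ^ 2 + u + 1 = 0) : cubicValue u e₀ e₁ e₂ e₃ u = e₂ := by
  simp [cubicValue, ne_one_of_sq_add_self_add_one_eq_zero hu,
    ne_zero_of_sq_add_self_add_one_eq_zero hu]

lemma cubicValue_sq (hu : u ^ 2 + u + 1 = 0) : cubicValue u e₀ e₁ e₂ e₃ (u ^ 2) = e₃ := by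
  have h0 := ne_zero_of_sq_add_self_add_one_eq_zero hu
  have h1 := ne_one_of_sq_add_self_add_one_eq_zero hu
  have h2 : u ^ 2 ≠ 1 := by
    intro h
    have h3 : u = 1 := by linear_combination (u - 1) * hu - u * h
    exact h1 h3
  have h3 : u ^ 2 ≠ u := by
    intro h
    exact h1 (mul_left_cancel₀ h0 (by linear_combination h))
  simp [cubicValue, h0, h2, h3]

/-- Distribution of `c (e (χ x) + e (v χ y) + e (v² χ (x + y)))` over all pairs `(x, y)`, where
`v` is a primitive cube root of unity and `e` is the function `cubicValue`. -/
theorem MulChar.sum_ite_cubicValue_eq {F : Type*} [Field F] [Fintype F] {u v : ℂ}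
    (hu : u ^ 2 + u + 1 = 0) (hv : v = u ∨ v = u ^ 2)
    {χ : MulChar F ℂ} (hχ : χ ^ 3 = 1) (h1 : χ ≠ 1) {r e₀ e₁ e₂ e₃ : ℂ}
    (hr : r = Fintype.card F) (he₀ : e₀ = (r - 1) / 3) (he : e₁ + e₂ + e₃ = -1) {T A B : ℂ}
    (hT : T = -(jacobiSum χ χ + jacobiSum χ⁻¹ χ⁻¹))
    (hA : A = -(u ^ 2 * jacobiSum χ χ + u * jacobiSum χ⁻¹ χ⁻¹))
    (hB : B = -(u * jacobiSum χ χ + u ^ 2 * jacobiSum χ⁻¹ χ⁻¹)) (c X : ℂ) :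
    ∑ x, ∑ y, (if c * (cubicValue u e₀ e₁ e₂ e₃ (χ x) + cubicValue u e₀ e₁ e₂ e₃ (v * χ y) +
      cubicValue u e₀ e₁ e₂ e₃ (v ^ 2 * χ (x + y))) = X then (1 : ℂ) else 0) =
    (if 3 * c * e₁ = X then (r - 1) * (r + 1 - T) / 27 else 0) +
      (if 3 * c * e₂ = X then (r - 1) * (r + 1 - T) / 27 else 0) +
      (if 3 * c * e₃ = X then (r - 1) * (r + 1 - T) / 27 else 0) +
      (if c * (2 * e₁ + e₂) = X then (r - 1) * (r - 2 - A) / 9 else 0) +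
      (if c * (2 * e₁ + e₃) = X then (r - 1) * (r - 2 - B) / 9 else 0) +
      (if c * (2 * e₂ + e₁) = X then (r - 1) * (r - 2 - B) / 9 else 0) +
      (if c * (2 * e₂ + e₃) = X then (r - 1) * (r - 2 - A) / 9 else 0) +
      (if c * (2 * e₃ + e₁) = X then (r - 1) * (r - 2 - A) / 9 else 0) +
      (if c * (2 * e₃ + e₂) = X then (r - 1) * (r - 2 - B) / 9 else 0) +
      (if -c = X then (r - 1) * (2 * r - 7 - 2 * T) / 9 else 0) +
      (if c * ((r - 1) / 3 + e₁ + e₂) = X then r - 1 else 0) +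
      (if c * ((r - 1) / 3 + e₁ + e₃) = X then r - 1 else 0) +
      (if c * ((r - 1) / 3 + e₂ + e₃) = X then r - 1 else 0) +
      (if c * (r - 1) = X then 1 else 0) := by
  have hu3 : u ^ 3 = 1 := by linear_combination (u - 1) * hu
  have hu4 : u ^ 4 = u := by linear_combination u * hu3
  have hself := cubicValue_self e₀ e₁ e₂ e₃ hu
  have hsq := cubicValue_sq e₀ e₁ e₂ e₃ hu
  rw [MulChar.sum_comp_apply_add hu hχ h1 (fun z₀ z₁ z₂ =>
    if c * (cubicValue u e₀ e₁ e₂ e₃ z₀ + cubicValue u e₀ e₁ e₂ e₃ (v * z₁) +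
      cubicValue u e₀ e₁ e₂ e₃ (v ^ 2 * z₂)) = X then (1 : ℂ) else 0)]
  simp only [MulChar.sum_levelInd_pow hu hχ h1, ← hr]
  generalize jacobiSum χ χ = J at *
  generalize jacobiSum χ⁻¹ χ⁻¹ = J' at *
  obtain ⟨D, hD⟩ : ∃ D : ℂ → ℂ, D = fun t => if c * t = X then (1 : ℂ) else 0 := ⟨_, rfl⟩
  have hD₁ : ∀ t, (if c * t = X then (1 : ℂ) else 0) = D t := fun t => by rw [hD]
  have hDw : ∀ (w t t' : ℂ), t' = c * t → (if t' = X then w else 0) = w * D t := by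
    rintro w t _ rfl
    rw [hD, mul_boole]
  have hDr : D (r - 1) = D (e₀ + e₀ + e₀) := by rw [he₀]; ring_nf
  simp only [hD₁]
  rw [hDw _ (e₁ + e₁ + e₁) (3 * c * e₁) (by ring), hDw _ (e₂ + e₂ + e₂) (3 * c * e₂) (by ring),
    hDw _ (e₃ + e₃ + e₃) (3 * c * e₃) (by ring), hDw _ _ (c * (2 * e₁ + e₂)) rfl,
    hDw _ _ (c * (2 * e₁ + e₃)) rfl, hDw _ _ (c * (2 * e₂ + e₁)) rfl,
    hDw _ _ (c * (2 * e₂ + e₃)) rfl, hDw _ _ (c * (2 * e₃ + e₁)) rfl,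
    hDw _ _ (c * (2 * e₃ + e₂)) rfl, hDw _ (e₁ + e₂ + e₃) (-c) (by rw [he]; ring),
    hDw _ _ (c * ((r - 1) / 3 + e₁ + e₂)) rfl, hDw _ _ (c * ((r - 1) / 3 + e₁ + e₃)) rfl,
    hDw _ _ (c * ((r - 1) / 3 + e₂ + e₃)) rfl, hDr, ← he₀]
  have hr' : r = 3 * e₀ + 1 := by linear_combination -3 * he₀
  clear hD₁ hDw hD hDr he₀ hr he
  subst hT hA hB hr'
  have huu : u * u ^ 2 = 1 := by linear_combination hu3
  have huu' : u ^ 2 * u = 1 := by linear_combination hu3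
  have hsq' : (u ^ 2) ^ 2 = u := by linear_combination hu4
  rcases hv with rfl | rfl <;>
  · simp [Fin.sum_univ_three, ← sq, huu, huu', hsq', hu4, hself, hsq]
    ring_nf

end CubicCount

section CubicPeriodValues

variable {F : Type*} [Field F] [Fintype F]

lemma cubicPeriod_zero {α : Fˣ} (hα : ∀ x : Fˣ, x ∈ Subgroup.zpowers α) {M : ℕ}
    (hM : 3 * M + 1 = Fintype.card F) (ψ : AddChar F ℂ) :
    cubicPeriod ψ 0 = ((Fintype.card F : ℂ) - 1) / 3 := by
  rw [cubicPeriod, sum_cubes_eq_sum_range hα hM fun z => ψ (z * 0), ← hM]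
  simp

lemma cubicPeriod_one_add_add {α : Fˣ} (hα : ∀ x : Fˣ, x ∈ Subgroup.zpowers α) {M : ℕ}
    (hM : 3 * M + 1 = Fintype.card F) {ψ : AddChar F ℂ} (hψ : ψ ≠ 1) :
    cubicPeriod ψ 1 + cubicPeriod ψ (α : F) + cubicPeriod ψ ((α : F) ^ 2) = -1 := by
  have ho : orderOf α = 3 * M := by rw [orderOf_generator hα]; omega
  have hM0 : 0 < 3 * M := by
    have := Fintype.one_lt_card (α := F)
    omega
  have h1 : ∑ y : Fˣ, ψ (y : F) = -1 := by
    have h := AddChar.sum_eq_zero_of_ne_one hψ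
    rw [sum_eq_apply_zero_add_sum_units, AddChar.map_zero_eq_one] at h
    linear_combination h
  have h2 : ∑ y : Fˣ, ψ (y : F) = ∑ i ∈ Finset.range (3 * M), ψ ((α : F) ^ i) := by
    symm
    refine Finset.sum_bij (fun i _ => α ^ i) (fun _ _ => Finset.mem_univ _) ?_ ?_ ?_
    · intro i hi j hj hij
      rw [Finset.mem_range, ← ho] at hi hj
      exact pow_injOn_Iio_orderOf hi hj hij
    · intro y _
      obtain ⟨i, hi⟩ := (mem_powers_iff_mem_zpowers).mpr (hα y)
      refine ⟨i % (3 * M), Finset.mem_range.mpr (Nat.mod_lt _ hM0), ?_⟩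
      rw [← ho, pow_mod_orderOf]
      exact hi
    · intro i _
      simp
  have h3 : ∀ v : F, cubicPeriod ψ v = ∑ i ∈ Finset.range M, ψ ((α : F) ^ (3 * i) * v) :=
    fun v => sum_cubes_eq_sum_range hα hM fun z => ψ (z * v)
  rw [← h1, h2, sum_range_three_mul, h3, h3, h3]
  simp only [Finset.sum_add_distrib, pow_succ, mul_one, pow_zero, one_mul, mul_assoc]

/-- A cubic period depends only on the value of a cubic character. -/
lemma cubicPeriod_eq_cubicValue {α : Fˣ} (hα : ∀ x : Fˣ, x ∈ Subgroup.zpowers α) {M : ℕ}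
    (hM : 3 * M + 1 = Fintype.card F) (ψ : AddChar F ℂ) {u : ℂ} (hu : u ^ 2 + u + 1 = 0)
    {χ : MulChar F ℂ} (hχα : χ (α : F) = u) (x : F) :
    cubicPeriod ψ x = cubicValue u (((Fintype.card F : ℂ) - 1) / 3) (cubicPeriod ψ 1)
      (cubicPeriod ψ (α : F)) (cubicPeriod ψ ((α : F) ^ 2)) (χ x) := by
  have hu3 : u ^ 3 = 1 := by linear_combination (u - 1) * hu
  rcases eq_or_ne x 0 with rfl | hx
  · rw [MulChar.map_zero, cubicValue_zero, cubicPeriod_zero hα hM]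
  · obtain ⟨i, rfl⟩ := exists_pow_eq_of_ne_zero hα hx
    have h1 : (α : F) ^ i = ((α : F) ^ (i / 3)) ^ 3 * (α : F) ^ (i % 3) := by
      rw [← pow_mul, ← pow_add, Nat.div_add_mod']
    rw [h1, cubicPeriod_mul_cube _ (pow_ne_zero _ α.ne_zero)]
    simp only [map_mul, map_pow, hχα]
    rw [← pow_mul, mul_comm _ 3, pow_mul, hu3, one_pow, one_mul]
    have h3 : i % 3 < 3 := Nat.mod_lt _ (by norm_num)
    interval_cases i % 3
    · simp
    · simp [cubicValue_self _ _ _ _ hu]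
    · rw [cubicValue_sq _ _ _ _ hu]

/-- Change of variables turning the three linear forms `a + b`, `a + b β`, `a + b β²` into
`x`, `y`, `x + y`, up to cubes. -/
lemma MulChar.sum_sum_apply_add_mul {β : F} (hβ : β ^ 2 + β + 1 = 0) (hβ1 : β ≠ 1)
    {χ : MulChar F ℂ} (hχ : χ ^ 3 = 1) (hχβ : χ β = 1) (H : ℂ → ℂ → ℂ → ℂ) :
    ∑ ab : F × F, H (χ (ab.1 + ab.2)) (χ (ab.1 + ab.2 * β)) (χ (ab.1 + ab.2 * β ^ 2)) =
      ∑ x : F, ∑ y : F, H (χ x) (χ y) (χ (x + y)) := by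
  have hβ0 : β ≠ 0 := by
    rintro rfl
    simp at hβ
  have hneg : χ (-1) = 1 := by
    have h := MulChar.apply_pow_three_eq_one hχ (x := -1) (by simp)
    rwa [← map_pow, Odd.neg_one_pow (n := 3) (by decide)] at h
  rw [← Fintype.sum_prod_type' fun x y => H (χ x) (χ y) (χ (x + y))]
  refine Fintype.sum_bijective (fun ab : F × F => (ab.1 + ab.2, β * (ab.1 + ab.2 * β)))
    (Finite.injective_iff_bijective.mp ?_) _ _ ?_
  · rintro ⟨a, b⟩ ⟨a', b'⟩ hab
    simp only [Prod.mk.injEq] at hab ⊢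
    obtain ⟨h1, h2⟩ := hab
    have h3 : β * (β - 1) * (b - b') = 0 := by linear_combination h2 - β * h1
    have h4 : b = b' := by
      simpa [hβ0, sub_eq_zero, hβ1] using h3
    exact ⟨by linear_combination h1 - h4, h4⟩
  · rintro ⟨a, b⟩
    have h1 : χ (β * (a + b * β)) = χ (a + b * β) := by rw [map_mul, hχβ, one_mul]
    have h2 : χ (a + b + β * (a + b * β)) = χ (a + b * β ^ 2) := by
      rw [show a + b + β * (a + b * β) = -1 * (β ^ 2 * (a + b * β ^ 2)) by
        linear_combination (a + b * (β ^ 2 - β + 1)) * hβ]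
      rw [map_mul, map_mul, map_pow, hneg, hχβ, one_pow, one_mul, one_mul]
    simp only [h1, h2]

end CubicPeriodValues

/-- STATEMENT 2: Weight distribution of `C_{(q,m,h,3)}` for `e = N = 3`,
`p ≡ 1 (mod 3)`, `3 ∣ m` and `3 ∤ (q−1)/h` (Table 4). -/
theorem stmt_3 (p s m h : ℕ) (hp : p.Prime) (hp3 : p % 3 = 1) (hs : 1 ≤ s) (hm : 1 ≤ m)
    (hm3 : 3 ∣ m)
    (q r : ℕ) (hq : q = p ^ s) (hr : r = q ^ m)
    (hh : 0 < h) (hhq : h ∣ q - 1)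
    (he : 3 ∣ Nat.gcd (q - 1) (h * m))
    (hN : Nat.gcd ((r - 1) / (q - 1)) (3 * (q - 1) / h) = 3)
    (hdvd : ¬ 3 ∣ (q - 1) / h)
    (K F : Type) [Field K] [Field F] [Algebra K F] [Fintype K] [Fintype F]
    [Algebra (ZMod p) F]
    (hcardK : Fintype.card K = q) (hcardF : Fintype.card F = r)
    (α : Fˣ) (hα : ∀ x : Fˣ, x ∈ Subgroup.zpowers α)
    (g β : F) (hg : g = (α : F) ^ ((q - 1) / h)) (hβ : β = (α : F) ^ ((r - 1) / 3))
    (n : ℕ) (hn : n = h * (r - 1) / (q - 1))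
    (lam : F → F → ℂ)
    (hlam : ∀ a b : F, lam a b = (h : ℂ) * ((r : ℂ) - 1) / q -
      (Set.ncard {i : Fin n |
        Algebra.trace K F (a * g ^ (i : ℕ) + b * (β * g) ^ (i : ℕ)) ≠ 0} : ℂ))
    (ψ : F → ℂ)
    (hψ : ∀ x : F, ψ x = Complex.exp (2 * Real.pi * Complex.I *
      (ZMod.val (Algebra.trace (ZMod p) F x)) / p))
    (η : F → ℂ)
    (hη : ∀ u : F, η u =
      ∑ z ∈ Finset.univ.filter (fun x : F => x ≠ 0 ∧ ∃ y : F, y ^ 3 = x), ψ (z * u))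
    (η₁ ηa ηa2 : ℂ) (hη₁ : η₁ = η 1) (hηa : ηa = η (α : F)) (hηa2 : ηa2 = η ((α : F) ^ 2))
    (a₀ b₀ : ℤ) (hpab : (p : ℤ) = a₀ ^ 2 - a₀ * b₀ + b₀ ^ 2)
    (ha₀ : a₀ % 3 = 2) (hb₀ : b₀ % 3 = 0) (hb₀pos : 0 < b₀)
    (ω πc : ℂ) (hω : ω = (-1 + Complex.I * Real.sqrt 3) / 2)
    (hπ : πc = (a₀ : ℂ) + (b₀ : ℂ) * ω)
    (b' : ℤ) (hb' : (b₀ * b') % p = 1)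
    (uα : ℂ)
    (huα₁ : ((α : F) ^ ((r - 1) / (p - 1))) ^ ((p - 1) / 3) =
      algebraMap (ZMod p) F ((-(b' * a₀) : ℤ) : ZMod p) → uα = ω)
    (huα₂ : ((α : F) ^ ((r - 1) / (p - 1))) ^ ((p - 1) / 3) =
      algebraMap (ZMod p) F ((-1 + b' * a₀ : ℤ) : ZMod p) → uα = ω ^ 2)
    (T A B : ℂ)
    (hT : T = (-1 : ℂ) ^ (m * s) * (πc ^ (m * s) + (starRingEnd ℂ πc) ^ (m * s)))
    (hA : A = (-1 : ℂ) ^ (m * s) *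
      (uα ^ 2 * πc ^ (m * s) + uα * (starRingEnd ℂ πc) ^ (m * s)))
    (hB : B = (-1 : ℂ) ^ (m * s) *
      (uα * πc ^ (m * s) + uα ^ 2 * (starRingEnd ℂ πc) ^ (m * s))) :
    (∀ a b : F,
      lam a b = 3 * (h : ℂ) / q * η₁ ∨
      lam a b = 3 * (h : ℂ) / q * ηa ∨
      lam a b = 3 * (h : ℂ) / q * ηa2 ∨
      lam a b = (h : ℂ) / q * (2 * η₁ + ηa) ∨
      lam a b = (h : ℂ) / q * (2 * η₁ + ηa2) ∨
      lam a b = (h : ℂ) / q * (2 * ηa + η₁) ∨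
      lam a b = (h : ℂ) / q * (2 * ηa + ηa2) ∨
      lam a b = (h : ℂ) / q * (2 * ηa2 + η₁) ∨
      lam a b = (h : ℂ) / q * (2 * ηa2 + ηa) ∨
      lam a b = -(h : ℂ) / q ∨
      lam a b = (h : ℂ) / q * (((r : ℂ) - 1) / 3 + η₁ + ηa) ∨
      lam a b = (h : ℂ) / q * (((r : ℂ) - 1) / 3 + η₁ + ηa2) ∨
      lam a b = (h : ℂ) / q * (((r : ℂ) - 1) / 3 + ηa + ηa2) ∨
      lam a b = (h : ℂ) * ((r : ℂ) - 1) / q) ∧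
    (∀ x : ℂ, (Set.ncard {ab : F × F | lam ab.1 ab.2 = x} : ℂ) =
      (if 3 * (h : ℂ) / q * η₁ = x then ((r : ℂ) - 1) * ((r : ℂ) + 1 - T) / 27 else 0) +
      (if 3 * (h : ℂ) / q * ηa = x then ((r : ℂ) - 1) * ((r : ℂ) + 1 - T) / 27 else 0) +
      (if 3 * (h : ℂ) / q * ηa2 = x then ((r : ℂ) - 1) * ((r : ℂ) + 1 - T) / 27 else 0) +
      (if (h : ℂ) / q * (2 * η₁ + ηa) = x then
        ((r : ℂ) - 1) * ((r : ℂ) - 2 - A) / 9 else 0) +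
      (if (h : ℂ) / q * (2 * η₁ + ηa2) = x then
        ((r : ℂ) - 1) * ((r : ℂ) - 2 - B) / 9 else 0) +
      (if (h : ℂ) / q * (2 * ηa + η₁) = x then
        ((r : ℂ) - 1) * ((r : ℂ) - 2 - B) / 9 else 0) +
      (if (h : ℂ) / q * (2 * ηa + ηa2) = x then
        ((r : ℂ) - 1) * ((r : ℂ) - 2 - A) / 9 else 0) +
      (if (h : ℂ) / q * (2 * ηa2 + η₁) = x then
        ((r : ℂ) - 1) * ((r : ℂ) - 2 - A) / 9 else 0) +
      (if (h : ℂ) / q * (2 * ηa2 + ηa) = x then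
        ((r : ℂ) - 1) * ((r : ℂ) - 2 - B) / 9 else 0) +
      (if -(h : ℂ) / q = x then ((r : ℂ) - 1) * (2 * (r : ℂ) - 7 - 2 * T) / 9 else 0) +
      (if (h : ℂ) / q * (((r : ℂ) - 1) / 3 + η₁ + ηa) = x then (r : ℂ) - 1 else 0) +
      (if (h : ℂ) / q * (((r : ℂ) - 1) / 3 + η₁ + ηa2) = x then (r : ℂ) - 1 else 0) +
      (if (h : ℂ) / q * (((r : ℂ) - 1) / 3 + ηa + ηa2) = x then (r : ℂ) - 1 else 0) +
      (if (h : ℂ) * ((r : ℂ) - 1) / q = x then 1 else 0)) := by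
  have : Fact p.Prime := ⟨hp⟩
  have hcharF : CharP F p := charP_of_injective_algebraMap (algebraMap (ZMod p) F).injective p
  obtain rfl : ψ = traceChar p F := funext fun x => by rw [hψ, traceChar_eq_exp]
  obtain rfl : η = cubicPeriod (traceChar p F) := funext fun x => hη x
  clear hψ hη
  -- arithmetic of the parameters
  have hq1 : 1 < q := hcardK ▸ Fintype.one_lt_card
  have hr1 : 1 < r := hcardF ▸ Fintype.one_lt_card
  have h3q : 3 ∣ q - 1 := he.trans (Nat.gcd_dvd_left _ _)
  have hdr : q - 1 ∣ r - 1 := by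
    simpa [hr] using Nat.sub_dvd_pow_sub_pow q 1 m
  obtain ⟨R, hR⟩ : ∃ R, R = (r - 1) / (q - 1) := ⟨_, rfl⟩
  obtain ⟨d, hd⟩ : ∃ d, d = (q - 1) / h := ⟨_, rfl⟩
  have hqR : (q - 1) * R = r - 1 := by rw [hR, Nat.mul_div_cancel' hdr]
  have hdh : d * h = q - 1 := by rw [hd, Nat.div_mul_cancel hhq]
  rw [← hR, Nat.mul_div_assoc 3 hhq, ← hd] at hN
  have h3R : 3 ∣ R := hN ▸ Nat.gcd_dvd_left _ _
  rw [← hd] at hdvd hg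
  obtain ⟨n', rfl⟩ : ∃ n', n = 3 * n' := by
    rw [hn, Nat.mul_div_assoc h hdr, ← hR]
    exact h3R.mul_left h
  have hn' : 3 * n' = h * R := by rw [hn, Nat.mul_div_assoc h hdr, ← hR]
  obtain ⟨M', hM'⟩ : 9 ∣ r - 1 := by
    rw [← hqR]
    exact mul_dvd_mul h3q h3R
  have hMeq : (r - 1) / 3 = 3 * M' := by omega
  have hM : 3 * (3 * M') + 1 = r := by omega
  have hM0 : 3 * M' ≠ 0 := by omega
  rw [hMeq] at hβ
  subst hg
  -- `β` is a primitive cube root of unity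
  have ho : orderOf α = r - 1 := by rw [orderOf_generator hα, hcardF]
  have hβ3 : β ^ 3 = 1 := by
    have h1 : α ^ (3 * M' * 3) = 1 := by
      rw [show 3 * M' * 3 = r - 1 by omega, ← ho, pow_orderOf_eq_one]
    rw [hβ, ← pow_mul]
    simpa using congrArg Units.val h1
  have hβ1 : β ≠ 1 := by
    intro h1
    have h2 : α ^ (3 * M') = 1 := by
      ext
      simpa [hβ] using h1
    have h3 := Nat.le_of_dvd (by omega) (orderOf_dvd_of_pow_eq_one h2)
    omega
  have hβ2 : β ^ 2 + β + 1 = 0 :=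
    mul_left_cancel₀ (sub_ne_zero.mpr hβ1) (by linear_combination hβ3)
  -- the cubic character and its Jacobi sums
  have hω2 : ω ^ 2 + ω + 1 = 0 := by
    have h1 : ((Real.sqrt 3 : ℝ) : ℂ) ^ 2 = 3 := by
      rw [← Complex.ofReal_pow, Real.sq_sqrt (by norm_num)]
      norm_num
    rw [hω]
    linear_combination (1 / 4 : ℂ) * Complex.I ^ 2 * h1 + 3 / 4 * Complex.I_sq
  have hωc : starRingEnd ℂ ω = ω ^ 2 := by
    have h1 : starRingEnd ℂ ω = (-1 - Complex.I * Real.sqrt 3) / 2 := by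
      rw [hω]
      simp [Complex.conj_ofNat]
      ring
    rw [h1]
    linear_combination -hω2 + hω
  have hpF : (p : F) = 0 := CharP.cast_eq_zero F p
  have hbb : (b₀ : F) * b' = 1 := by
    have h1 := Int.emod_add_mul_ediv (b₀ * b') p
    rw [hb'] at h1
    have h2 := congrArg (Int.cast : ℤ → F) h1
    push_cast at h2
    rw [hpF] at h2
    linear_combination -h2
  have hb₀F : (b₀ : F) ≠ 0 := left_ne_zero_of_mul_eq_one hbb
  obtain ⟨γ, hγ⟩ : ∃ γ : F, γ = -(b' * a₀) := ⟨_, rfl⟩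
  have hγ0 : (a₀ : F) + b₀ * γ = 0 := by
    rw [hγ]
    linear_combination -(a₀ : F) * hbb
  have hγ2 : γ ^ 2 + γ + 1 = 0 := by
    have h1 : (p : F) = (a₀ : F) ^ 2 - a₀ * b₀ + (b₀ : F) ^ 2 := by
      exact_mod_cast congrArg (Int.cast : ℤ → F) hpab
    rw [hpF] at h1
    refine mul_left_cancel₀ (pow_ne_zero 2 hb₀F) ?_
    linear_combination (b₀ * γ - a₀ + b₀) * hγ0 - h1
  have hpr : ((α : F) ^ ((r - 1) / (p - 1))) ^ ((p - 1) / 3) = β := by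
    have h1 : p - 1 ∣ r - 1 := by
      rw [hr, hq, ← pow_mul]
      simpa using Nat.sub_dvd_pow_sub_pow p 1 (s * m)
    have h2 : (r - 1) / (p - 1) * ((p - 1) / 3) = 3 * M' := by
      have h3 : (p - 1) / 3 * 3 = p - 1 := Nat.div_mul_cancel (by omega)
      have h4 : (r - 1) / (p - 1) * (p - 1) = r - 1 := Nat.div_mul_cancel h1
      have h5 : (r - 1) / (p - 1) * ((p - 1) / 3) * 3 = 3 * M' * 3 := by
        rw [mul_assoc, h3, h4]
        omega
      omega
    rw [← pow_mul, h2, hβ]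
  rw [hpr] at huα₁ huα₂
  have hcases : ((α : F) ^ (3 * M') = γ ∧ uα = ω) ∨ ((α : F) ^ (3 * M') = γ ^ 2 ∧ uα = ω ^ 2) := by
    rw [← hβ]
    have h1 : (β - γ) * (β - (-1 - γ)) = 0 := by linear_combination hβ2 - hγ2
    rcases mul_eq_zero.mp h1 with h2 | h2
    · refine Or.inl ⟨sub_eq_zero.mp h2, huα₁ ?_⟩
      rw [map_intCast, sub_eq_zero.mp h2, hγ]
      push_cast
      ring
    · refine Or.inr ⟨by linear_combination h2 - hγ2, huα₂ ?_⟩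
      rw [map_intCast, sub_eq_zero.mp h2, hγ]
      push_cast
      ring
  have hrp : r = p ^ (m * s) := by rw [hr, hq, ← pow_mul, mul_comm]
  obtain ⟨χ, hχ3, hχα, hJ, hJ'⟩ := exists_mulChar_jacobiSum_eq hp hp3 (hcardF.trans hrp)
    (hM.trans hrp) hM0 hα hpab ha₀ hb₀ hb₀F hγ0 hω2 hωc hcases
  rw [← hπ] at hJ hJ'
  have hu : uα ^ 2 + uα + 1 = 0 := by
    rcases hcases with ⟨-, rfl⟩ | ⟨-, rfl⟩
    · exact hω2
    · linear_combination (ω ^ 2 - ω + 1) * hω2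
  have hu3 : uα ^ 3 = 1 := by linear_combination (uα - 1) * hu
  have hχ1 : χ ≠ 1 := by
    rintro rfl
    rw [MulChar.one_apply_coe] at hχα
    exact ne_one_of_sq_add_self_add_one_eq_zero hu hχα.symm
  have hχβ : χ β = 1 := by
    rw [hβ, map_pow, hχα, pow_mul, hu3, one_pow]
  have hv : uα ^ d = uα ∨ uα ^ d = uα ^ 2 := by
    have h1 : uα ^ d = uα ^ (d % 3) := by
      conv_lhs => rw [← Nat.div_add_mod d 3, pow_add, pow_mul, hu3, one_pow, one_mul]
    rw [h1]
    have h2 : d % 3 = 1 ∨ d % 3 = 2 := by omega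
    rcases h2 with h2 | h2 <;> simp [h2]
  -- the modified weight in terms of the cubic character
  have hMF : 3 * (3 * M') + 1 = Fintype.card F := hM.trans hcardF.symm
  have hlam' : ∀ a b, lam a b = (h : ℂ) / q *
      (cubicValue uα (((r : ℂ) - 1) / 3) η₁ ηa ηa2 (χ (a + b)) +
      cubicValue uα (((r : ℂ) - 1) / 3) η₁ ηa ηa2 (uα ^ d * χ (a + b * β)) +
      cubicValue uα (((r : ℂ) - 1) / 3) η₁ ηa ηa2 ((uα ^ d) ^ 2 * χ (a + b * β ^ 2))) := by
    intro a b
    have h1 := modifiedWeight_eq_sum_cubicPeriod (K := K) p hα hMF (by rw [hcardK, hcardF, hqR])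
      h3R (by rw [hcardK, hdh]) hN hn' hβ3 a b
    rw [hcardK, hcardF] at h1
    have h2 := cubicPeriod_eq_cubicValue hα hMF (traceChar p F) hu hχα
    rw [hcardF, ← hη₁, ← hηa, ← hηa2] at h2
    rw [hlam, h1, h2, h2, h2, map_mul, map_mul, map_pow, map_pow, hχα, ← pow_mul uα d 2,
      mul_comm d 2]
  have hsum : η₁ + ηa + ηa2 = -1 := by
    rw [hη₁, hηa, hηa2]
    refine cubicPeriod_one_add_add hα hMF fun h1 => ?_
    exact traceChar_isPrimitive p F one_ne_zero (by simpa using h1)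
  refine (and_iff_right_of_imp fun hcount a b => ?_).mpr fun x => ?_
  · by_contra hne
    simp only [not_or] at hne
    obtain ⟨h1, h2, h3, h4, h5, h6, h7, h8, h9, h10, h11, h12, h13, h14⟩ := hne
    have h0 := hcount (lam a b)
    rw [if_neg (Ne.symm h1), if_neg (Ne.symm h2), if_neg (Ne.symm h3), if_neg (Ne.symm h4),
      if_neg (Ne.symm h5), if_neg (Ne.symm h6), if_neg (Ne.symm h7), if_neg (Ne.symm h8),
      if_neg (Ne.symm h9), if_neg (Ne.symm h10), if_neg (Ne.symm h11), if_neg (Ne.symm h12),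
      if_neg (Ne.symm h13), if_neg (Ne.symm h14)] at h0
    simp only [add_zero, Nat.cast_eq_zero] at h0
    rw [Set.ncard_eq_zero] at h0
    have hmem : (a, b) ∈ {ab : F × F | lam ab.1 ab.2 = lam a b} := rfl
    rw [h0] at hmem
    exact hmem
  · have h1 : (Set.ncard {ab : F × F | lam ab.1 ab.2 = x} : ℂ) =
        ∑ ab : F × F, if lam ab.1 ab.2 = x then (1 : ℂ) else 0 := by
      rw [Set.ncard_eq_toFinset_card', Finset.sum_boole]
      congr 2
      ext
      simp
    simp only [hlam'] at h1
    rw [MulChar.sum_sum_apply_add_mul hβ2 hβ1 hχ3 hχβ (fun z₀ z₁ z₂ => if (h : ℂ) / q *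
      (cubicValue uα (((r : ℂ) - 1) / 3) η₁ ηa ηa2 z₀ +
      cubicValue uα (((r : ℂ) - 1) / 3) η₁ ηa ηa2 (uα ^ d * z₁) +
      cubicValue uα (((r : ℂ) - 1) / 3) η₁ ηa ηa2 ((uα ^ d) ^ 2 * z₂)) = x then (1 : ℂ) else 0),
      MulChar.sum_ite_cubicValue_eq hu hv hχ3 hχ1 (by rw [hcardF]) rfl hsum (T := T) (A := A)
        (B := B) (by rw [hT, hJ, hJ']; ring) (by rw [hA, hJ, hJ']; ring)
        (by rw [hB, hJ, hJ']; ring)] at h1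
    simp only [← hlam'] at h1
    rw [← mul_div_assoc (3 : ℂ), ← neg_div, div_mul_eq_mul_div (h : ℂ) q ((r : ℂ) - 1)] at h1
    exact h1
end

section
/- If (q, h, e, m) ≠ (3, 1, 2, 2), then the minimal polynomial of g^{−1} over GF(q) and the minimal polynomial of (βg)^{−1} over GF(q) are distinct. -/
/-- Two elements of a finite extension of finite fields with the same minimal polynomial
are related by a power of the Frobenius. -/
theorem FiniteField.exists_pow_card_pow_eq_of_minpoly_eq {K F : Type*} [Field K] [Field F]
    [Algebra K F] [Fintype K] [Fintype F] {x y : F} (hxy : minpoly K x = minpoly K y) :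
    ∃ i < Module.finrank K F, y = x ^ Fintype.card K ^ i := by
  obtain ⟨σ, hσ⟩ := (isConjRoot_iff_exists_algEquiv (K := K) (x := y) (y := x)).1 hxy.symm
  obtain ⟨i, hi⟩ := (FiniteField.bijective_frobeniusAlgEquivOfAlgebraic_pow K F).2 σ
  refine ⟨i, i.2, ?_⟩
  rw [← hσ, ← hi]
  simp [FiniteField.coe_frobeniusAlgEquivOfAlgebraic_iterate, AlgEquiv.coe_pow]

/-- The only solution of `e * k * (q ^ i - 1) = q ^ m - 1` with `0 < i < m`, `1 < e` and
`e`, `k` dividing `q - 1` is `(q, k, e, m) = (3, 2, 2, 2)`. -/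
theorem Nat.eq_of_mul_pow_sub_one_eq_pow_sub_one {q e k i m : ℕ} (hq : 2 ≤ q) (he : 1 < e)
    (heq : e ∣ q - 1) (hkq : k ∣ q - 1) (hi : 0 < i) (him : i < m)
    (h : e * k * (q ^ i - 1) = q ^ m - 1) : q = 3 ∧ k = 2 ∧ e = 2 ∧ m = 2 := by
  obtain ⟨a, rfl⟩ : ∃ a, q = a + 1 := ⟨q - 1, by omega⟩
  simp only [Nat.add_sub_cancel] at heq hkq
  have ha : 0 < a := by omega
  have hc : e * k ≤ a * a := Nat.mul_le_mul (Nat.le_of_dvd ha heq) (Nat.le_of_dvd ha hkq)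
  obtain ⟨j, rfl⟩ : ∃ j, m = i + 1 + j := ⟨m - i - 1, by omega⟩
  obtain ⟨Q, hQ⟩ : ∃ Q, (a + 1) ^ i = Q + 1 :=
    ⟨(a + 1) ^ i - 1, by have := Nat.one_le_pow i (a + 1) (by omega); omega⟩
  have hQa : a ≤ Q := by
    have := Nat.pow_le_pow_right (n := a + 1) (by omega) hi
    simp at this; omega
  rw [pow_add, pow_succ, hQ, Nat.add_sub_cancel] at h
  have hj : j = 0 := by
    by_contra hj
    have h1 : (a + 1) ^ 1 ≤ (a + 1) ^ j := Nat.pow_le_pow_right (by omega) (by omega)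
    have h2 : (Q + 1) * (a + 1) * (a + 1) ≤ (Q + 1) * (a + 1) * (a + 1) ^ j :=
      Nat.mul_le_mul_left _ (by simpa using h1)
    have h3 : e * k * Q ≤ a * a * Q := Nat.mul_le_mul_right _ hc
    have h4 : (Q + 1) * (a + 1) * (a + 1) = a * a * Q + 1 + (2 * a * Q + Q + a * a + 2 * a) := by
      ring
    have : 0 < a * a := by positivity
    omega
  subst hj
  have h' : e * k * Q = (a + 1) * Q + a := by
    rw [h, pow_zero, mul_one, show (Q + 1) * (a + 1) = (a + 1) * Q + a + 1 by ring]; rfl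
  have hQ' : Q = a := by
    refine le_antisymm (Nat.le_of_dvd ha ?_) hQa
    exact (Nat.dvd_add_right (Dvd.intro_left _ rfl)).1 (h' ▸ Dvd.intro_left _ rfl)
  subst hQ'
  have hi1 : i = 1 := Nat.pow_right_injective hq (by simpa using hQ)
  have hek : e * k = Q + 2 := Nat.eq_of_mul_eq_mul_right ha (by rw [h']; ring)
  have he2 : e ∣ 2 := (Nat.dvd_add_right heq).1 (hek ▸ Dvd.intro _ rfl)
  have hk2 : k ∣ 2 := (Nat.dvd_add_right hkq).1 (hek ▸ Dvd.intro_left _ rfl)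
  have := Nat.le_of_dvd two_pos he2
  have := Nat.le_of_dvd two_pos hk2
  obtain rfl : e = 2 := by omega
  omega

/-- If `(q, h, e, m) ≠ (3, 1, 2, 2)`, the minimal polynomials of `g⁻¹`
and `(βg)⁻¹` over `GF(q)` are distinct. -/
theorem stmt_4 (p s m h e : ℕ) (hp : p.Prime) (hs : 1 ≤ s) (hm : 1 ≤ m)
    (q r : ℕ) (hq : q = p ^ s) (hr : r = q ^ m)
    (hh : 0 < h) (hhq : h ∣ q - 1)
    (he : 1 < e) (hegcd : e ∣ Nat.gcd (q - 1) (h * m))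
    (K F : Type) [Field K] [Field F] [Algebra K F] [Fintype K] [Fintype F]
    (hcardK : Fintype.card K = q) (hcardF : Fintype.card F = r)
    (α : Fˣ) (hα : ∀ x : Fˣ, x ∈ Subgroup.zpowers α)
    (g β : F) (hg : g = (α : F) ^ ((q - 1) / h)) (hβ : β = (α : F) ^ ((r - 1) / e))
    (hexc : ¬(q = 3 ∧ h = 1 ∧ e = 2 ∧ m = 2)) :
    minpoly K g⁻¹ ≠ minpoly K (β * g)⁻¹ := by
  intro hmin
  have hq2 : 2 ≤ q := hcardK ▸ Fintype.one_lt_card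
  have hfin : Module.finrank K F = m := by
    have := Module.card_eq_pow_finrank (K := K) (V := F)
    rw [hcardK, hcardF, hr] at this
    exact (Nat.pow_right_injective hq2 this).symm
  obtain ⟨i, him, hi⟩ := FiniteField.exists_pow_card_pow_eq_of_minpoly_eq hmin
  rw [hfin] at him
  rw [hcardK, inv_pow, inv_inj] at hi
  obtain ⟨k, hk⟩ := hhq
  have hkq : (q - 1) / h = k := by rw [hk, Nat.mul_div_cancel_left _ hh]
  have heq : e ∣ q - 1 := hegcd.trans (Nat.gcd_dvd_left _ _)
  obtain ⟨t, ht⟩ : e ∣ r - 1 := heq.trans (by simpa [hr] using Nat.sub_dvd_pow_sub_pow q 1 m)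
  have htr : (r - 1) / e = t := by rw [ht, Nat.mul_div_cancel_left _ (by omega)]
  have hord : orderOf α = r - 1 := by
    rw [orderOf_eq_card_of_forall_mem_zpowers hα, Nat.card_units, Nat.card_eq_fintype_card, hcardF]
  have hr2 : 2 ≤ r := hcardF ▸ Fintype.one_lt_card
  have hk0 : 0 < k := Nat.pos_of_ne_zero (by rintro rfl; omega)
  have ht0 : 0 < t := Nat.pos_of_ne_zero (by rintro rfl; omega)
  have htlt : t < r - 1 := by rw [ht]; nlinarith
  obtain ⟨Q, hQ⟩ : ∃ Q, q ^ i = Q + 1 :=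
    ⟨q ^ i - 1, by have := Nat.one_le_pow i q (by omega); omega⟩
  have hpow : α ^ t = α ^ (k * Q) := by
    have : α ^ t * α ^ k = α ^ (k * Q) * α ^ k := by
      ext
      rw [hg, hβ, hkq, htr, ← pow_mul, hQ, mul_add_one, pow_add] at hi
      simpa using hi
    exact mul_right_cancel this
  have hklt : k * Q < r - 1 := by
    have h1 : k ≤ q - 1 := Nat.le_of_dvd (by omega) ⟨h, by rw [hk, mul_comm]⟩
    have h2 : q ^ i * q ≤ r := by
      rw [hr, ← pow_succ]; exact Nat.pow_le_pow_right (by omega) him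
    obtain ⟨a, rfl⟩ : ∃ a, q = a + 1 := ⟨q - 1, by omega⟩
    rw [hQ] at h2
    have h3 : k * Q ≤ a * Q := Nat.mul_le_mul_right _ h1
    have h4 : (Q + 1) * (a + 1) = a * Q + Q + a + 1 := by ring
    omega
  have htk : t = k * Q := pow_injOn_Iio_orderOf (by simpa [hord]) (by simpa [hord]) hpow
  have hi0 : 0 < i := by
    refine Nat.pos_of_ne_zero ?_
    rintro rfl
    have : Q = 0 := by simpa using hQ
    simp [this] at htk; omega
  obtain ⟨rfl, rfl, rfl, rfl⟩ := Nat.eq_of_mul_pow_sub_one_eq_pow_sub_one hq2 he heq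
    (Dvd.intro_left _ hk.symm) hi0 him
    (by rw [hQ, ← hr, ht, htk, Nat.add_sub_cancel, mul_assoc])
  exact hexc ⟨rfl, by omega, rfl, rfl⟩
end

section
/- Let q ≥ 2 and m ≥ 1 be integers, h a positive divisor of q−1, and e > 1 an integer dividing gcd(q−1, hm). If a is an integer with 0 ≤ a ≤ m−1 such that ((q−1)/h)·(q^a − 1) = (q^m − 1)/e, then q = 3, h = 1, e = 2, m = 2 and a = 1. -/
/-- If `((q−1)/h)·(q^a − 1) = (q^m − 1)/e` with the stated divisibility
conditions, then `q = 3`, `h = 1`, `e = 2`, `m = 2`, `a = 1`. -/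
theorem stmt_5 (q m h e a : ℕ)
    (hq : 2 ≤ q) (hm : 1 ≤ m)
    (hh : 0 < h) (hhq : h ∣ q - 1)
    (he : 1 < e) (hegcd : e ∣ Nat.gcd (q - 1) (h * m))
    (ha : a ≤ m - 1)
    (heq : (q - 1) / h * (q ^ a - 1) = (q ^ m - 1) / e) :
    q = 3 ∧ h = 1 ∧ e = 2 ∧ m = 2 ∧ a = 1 := by
  have heq1 : e ∣ q - 1 := hegcd.trans (Nat.gcd_dvd_left _ _)
  have hem : e ∣ q ^ m - 1 := heq1.trans (by simpa using Nat.sub_dvd_pow_sub_pow q 1 m)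
  obtain ⟨k, hk⟩ := hhq
  rw [hk, Nat.mul_div_cancel_left k hh] at heq
  have hmul : e * k * (q ^ a - 1) = q ^ m - 1 := by
    rw [mul_assoc, heq, Nat.mul_div_cancel' hem]
  have hkpos : 0 < k := Nat.pos_of_ne_zero (by rintro rfl; omega)
  have hkle : k ≤ q - 1 := hk ▸ Nat.le_mul_of_pos_left k hh
  have hele : e ≤ q - 1 := Nat.le_of_dvd (by omega) heq1
  have hek : e * k ≤ (q - 1) * (q - 1) := Nat.mul_le_mul hele hkle
  have hek2 : 1 < e * k := lt_of_lt_of_le he (Nat.le_mul_of_pos_right e hkpos)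
  have hapos : 1 ≤ q ^ a := Nat.one_le_pow _ _ (by omega)
  have hmpos : 1 ≤ q ^ m := Nat.one_le_pow _ _ (by omega)
  have hdvd : q ^ a ∣ e * k - 1 := by
    obtain ⟨c, hc⟩ := pow_dvd_pow q (show a ≤ m by omega)
    zify [hapos, hmpos, hek2.le] at hmul hc ⊢
    exact ⟨e * k - c, by linear_combination -hmul - hc⟩
  have hqsq : (q - 1) * (q - 1) < q ^ 2 := by
    rw [pow_two]
    exact Nat.mul_lt_mul'' (by omega) (by omega)
  have ha2 : a < 2 := by
    refine (Nat.pow_lt_pow_iff_right (a := q) (by omega)).1 ?_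
    have := Nat.le_of_dvd (by omega) hdvd
    omega
  have ha1 : a = 1 := by
    rcases Nat.eq_zero_or_pos a with rfl | h0
    · have : 1 < q ^ m := Nat.one_lt_pow (by omega) (by omega)
      simp at hmul
      omega
    · omega
  subst ha1
  rw [pow_one] at hmul
  obtain ⟨r, rfl⟩ : ∃ r, q = r + 1 := ⟨q - 1, by omega⟩
  simp only [Nat.add_sub_cancel] at hk heq1 hek hmul
  have hm3 : m < 3 := by
    refine (Nat.pow_lt_pow_iff_right (a := r + 1) (by omega)).1 ?_
    have h1 : e * k * r ≤ r * r * r := Nat.mul_le_mul_right r hek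
    have h2 : (r + 1) ^ m = e * k * r + 1 := by omega
    rw [h2]
    nlinarith
  obtain rfl : m = 2 := by omega
  have hsum : e * k = r + 2 := by
    have h2 : e * k * r + 1 = (r + 1) ^ 2 := by omega
    exact Nat.eq_of_mul_eq_mul_right (show 0 < r by omega) (by linarith)
  have he2 : e ∣ 2 := (Nat.dvd_add_right heq1).1 (hsum ▸ Dvd.intro k rfl)
  have hk2 : k ∣ 2 :=
    (Nat.dvd_add_right (Dvd.intro_left h hk.symm)).1 (hsum ▸ Dvd.intro_left e rfl)
  obtain rfl : e = 2 := le_antisymm (Nat.le_of_dvd two_pos he2) he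
  have hkle2 := Nat.le_of_dvd two_pos hk2
  obtain rfl : k = 2 := by omega
  omega
end

section
/- Let p be an odd prime with p ≡ 2 (mod 3), t an even positive integer, and r = p^t. Then for every multiplicative character ρ of GF(r) of order 3, the Jacobi sum J(ρ,ρ) = Σ_{x ∈ GF(r)} ρ(x)ρ(1−x) satisfies J(ρ,ρ) = −(−1)^{t/2} p^{t/2}. -/
/-- Jacobi sums over a finite field of characteristic `p` are invariant under raising both
characters to the `p`-th power. -/
theorem jacobiSum_pow_char {F R : Type*} [Field F] [Fintype F] [CommRing R] (p : ℕ)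
    [Fact p.Prime] [CharP F p] (χ ψ : MulChar F R) :
    jacobiSum (χ ^ p) (ψ ^ p) = jacobiSum χ ψ := by
  have hp : p ≠ 0 := (Fact.out : p.Prime).ne_zero
  refine Fintype.sum_bijective (frobenius F p)
    (Finite.injective_iff_bijective.mp (frobenius_inj F p)) _ _ fun x ↦ ?_
  rw [MulChar.pow_apply' _ hp, MulChar.pow_apply' _ hp, ← map_one (frobenius F p), ← map_sub]
  simp only [frobenius_def, map_pow, one_pow]

/-- An integer that is `3` times an algebraic integer is divisible by `3`. -/
theorem three_dvd_of_eq_three_mul_isIntegral {n : ℤ} {w : ℂ} (hw : IsIntegral ℤ w)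
    (h : (n : ℂ) = 3 * w) : (3 : ℤ) ∣ n := by
  have hw' : w = algebraMap ℚ ℂ (n / 3) := by
    push_cast [eq_ratCast]
    rw [h]
    ring
  rw [hw', isIntegral_algebraMap_iff (algebraMap ℚ ℂ).injective] at hw
  obtain ⟨m, hm⟩ := IsIntegrallyClosed.isIntegral_iff.mp hw
  refine ⟨m, ?_⟩
  have hm' : (n : ℚ) = 3 * m := by
    rw [eq_intCast] at hm
    rw [hm]
    ring
  exact_mod_cast hm'

/-- If the Jacobi sum `J(χ,χ)` of a cubic character is an integer, it is congruent to `-1`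
modulo `3`. -/
theorem three_dvd_jacobiSum_add_one {F : Type*} [Field F] [Fintype F] {χ : MulChar F ℂ}
    (hχ : orderOf χ = 3) (hF : 3 ∣ Fintype.card F - 1) {n : ℤ} (hn : jacobiSum χ χ = n) :
    (3 : ℤ) ∣ n + 1 := by
  have hχ3 : χ ^ 3 = 1 := hχ ▸ pow_orderOf_eq_one χ
  obtain ⟨μ, hμ⟩ : ∃ μ : ℂ, IsPrimitiveRoot μ 3 :=
    ⟨_, Complex.isPrimitiveRoot_exp 3 (by norm_num)⟩
  obtain ⟨z, hz, hJ⟩ := exists_jacobiSum_eq_neg_one_add (by norm_num) hχ3 hχ3 hF hμ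
  have hμi : IsIntegral ℤ μ := hμ.isIntegral (by norm_num)
  have hμ2 : 1 + μ + μ ^ 2 = 0 := by
    simpa [Finset.sum_range_succ] using hμ.geom_sum_eq_zero (by norm_num)
  have hzi : IsIntegral ℤ z := IsIntegral.of_mem_of_fg _ hμi.fg_adjoin_singleton z hz
  refine three_dvd_of_eq_three_mul_isIntegral (hzi.mul hμi).neg ?_
  push_cast
  rw [← hn, hJ]
  linear_combination z * hμ2

/-- For `p` an odd prime with `p ≡ 2 (mod 3)`, `t` even positive, `r = p^t`,
every cubic character `ρ` of `GF(r)` satisfies `J(ρ,ρ) = −(−1)^{t/2} p^{t/2}`. -/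
theorem stmt_8 (p t : ℕ) (hp : p.Prime) (hodd : Odd p) (hp3 : p % 3 = 2)
    (ht : 0 < t) (hte : Even t)
    (F : Type) [Field F] [Fintype F] (hcardF : Fintype.card F = p ^ t)
    (ρ : MulChar F ℂ) (hρ : orderOf ρ = 3) :
    ∑ x : F, ρ x * ρ (1 - x) = -((-1 : ℂ) ^ (t / 2) * (p : ℂ) ^ (t / 2)) := by
  change jacobiSum ρ ρ = _
  have : Fact p.Prime := ⟨hp⟩
  have : CharP F p := charP_of_card_eq_prime_pow hcardF
  obtain ⟨s, rfl⟩ := hte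
  have hs : (s + s) / 2 = s := by lia
  rw [hs]
  have hρ1 : ρ ≠ 1 := fun h ↦ by simp [h] at hρ
  have hρ2 : ρ * ρ ≠ 1 := by
    rw [← pow_two]
    exact pow_ne_one_of_lt_orderOf two_ne_zero (by lia)
  have hρp : ρ ^ p = ρ⁻¹ := by
    rw [eq_inv_iff_mul_eq_one, ← pow_succ, ← orderOf_dvd_iff_pow_eq_one, hρ]
    lia
  have hchar : ringChar ℂ ≠ ringChar F := by
    rw [ringChar.eq_zero, ringChar.eq F p]
    exact hp.ne_zero.symm
  have hsq : jacobiSum ρ ρ ^ 2 = ((p : ℂ) ^ s) ^ 2 := by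
    have h := jacobiSum_mul_jacobiSum_inv hchar hρ1 hρ1 hρ2
    rw [← hρp, jacobiSum_pow_char, hcardF] at h
    rw [sq, h]
    push_cast
    ring
  have hmod : (p : ℤ) ≡ -1 [ZMOD 3] := by
    rw [Int.ModEq]
    lia
  have hmods : (-1) ^ s * (p : ℤ) ^ s ≡ 1 [ZMOD 3] := by
    simpa [← mul_pow] using (hmod.mul_left (-1)).pow s
  have hcard : 3 ∣ Fintype.card F - 1 := by
    rw [hcardF, ← two_mul, pow_mul]
    have h : 1 ≡ (p ^ 2) ^ s [MOD 3] := by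
      have h2 : 1 ≡ p ^ 2 [MOD 3] := by simp [Nat.ModEq, Nat.pow_mod, hp3]
      simpa using h2.pow s
    exact (Nat.modEq_iff_dvd' (Nat.one_le_pow _ _ (pow_pos hp.pos 2))).mp h
  have hsign : jacobiSum ρ ρ = (-1) ^ s * (p : ℂ) ^ s ∨
      jacobiSum ρ ρ = -((-1) ^ s * (p : ℂ) ^ s) := by
    rw [← sq_eq_sq_iff_eq_or_eq_neg, hsq, mul_pow, ← pow_mul (-1 : ℂ), mul_comm s 2, pow_mul]
    simp
  refine hsign.resolve_left fun h ↦ ?_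
  have h3 := three_dvd_jacobiSum_add_one hρ hcard (n := (-1) ^ s * (p : ℤ) ^ s)
    (by rw [h]; push_cast; rfl)
  rw [Int.ModEq] at hmods
  lia
end
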